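/- Let S = sgp⟨A | u = v⟩ be the one-relator monoid presented by A = {a_1,…,a_n} where u, v ∈ A^* with |u| = 2, |v| ≤ 2 and u ≠ v. Then S is prefix-automatic. Moreover, S is biautomatic if and only if the relation u = v is not of the form ab = a or ab = b for distinct letters a, b ∈ A. -/

import Mathlib

/-!  Common definitions, following the conventions of the paper
"Automaticity of one-relator semigroups with length less than or equal to three".

Words over an alphabet `α` are modelled as `List α`; the empty word is `[]`.
The padded alphabet `A(2,$)` is modelled inside `Option α × Option α`,
where `none` plays the role of the padding symbol `$` (the pair `(none, none)`
never occurs in a padded convolution). -/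

/-- A regular set of words: one accepted by a DFA with finitely many states. -/
abbrev IsReg {α : Type*} (L : Set (List α)) : Prop :=
  Language.IsRegular (L : Language α)

/-- Right-padded convolution `(x,y)δᴿ`: align the two words letter by letter
from the left and pad the shorter one on the right with the padding symbol. -/
def padR {α : Type*} (x y : List α) : List (Option α × Option α) :=
  (x.map some ++ List.replicate (y.length - x.length) none).zip
    (y.map some ++ List.replicate (x.length - y.length) none)

/-- Left-padded convolution `(x,y)δᴸ`: align the two words letter by letter
from the right and pad the shorter one on the left with the padding symbol. -/
def padL {α : Type*} (x y : List α) : List (Option α × Option α) :=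
  (List.replicate (y.length - x.length) none ++ x.map some).zip
    (List.replicate (x.length - y.length) none ++ y.map some)

/-- One elementary rewriting step: replace a factor `u` by `v`
for some defining relation `(u, v) ∈ R` (in either direction via `Relation.EqvGen`). -/
def OneStep {α : Type*} (R : Set (List α × List α)) (x y : List α) : Prop :=
  ∃ p u v s, (u, v) ∈ R ∧ x = p ++ u ++ s ∧ y = p ++ v ++ s

/-- Equality of two words in the semigroup `sgp⁺⟨α ∣ R⟩` (resp. the monoid
`sgp⟨α ∣ R⟩`): the congruence on words generated by the relations `R`. -/
def WordEq {α : Type*} (R : Set (List α × List α)) : List α → List α → Prop :=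
  Relation.EqvGen (OneStep R)

/-- Expansion of a word over an abstract generating set `β` into a word over the
presentation alphabet `α`, where `g b` is a word representing the generator `b`. -/
def expandW {α β : Type*} (g : β → List α) (w : List β) : List α :=
  (w.map g).flatten

/-- `(g, L)` is an automatic structure for the semigroup `sgp⁺⟨α ∣ R⟩` with
respect to the finite generating set indexed by `β`:  each generator `b` is the
element of the semigroup represented by the nonempty word `g b`, the language
`L ⊆ β⁺` is regular and maps onto the semigroup, and `L_ε^$` together with all
`L_b^$` (right multiplication, right padding) are regular. -/
structure SgpAutoStruct {α β : Type*} (R : Set (List α × List α))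
    (g : β → List α) (L : Set (List β)) : Prop where
  gen_ne : ∀ b, g b ≠ []
  reg : IsReg L
  ne : ∀ w ∈ L, w ≠ []
  onto : ∀ w : List α, w ≠ [] → ∃ x ∈ L, WordEq R (expandW g x) w
  eq_reg : IsReg {p | ∃ x ∈ L, ∃ y ∈ L,
      WordEq R (expandW g x) (expandW g y) ∧ p = padR x y}
  mul_reg : ∀ b : β, IsReg {p | ∃ x ∈ L, ∃ y ∈ L,
      WordEq R (expandW g x ++ g b) (expandW g y) ∧ p = padR x y}

/-- A prefix-automatic structure for `sgp⁺⟨α ∣ R⟩`: an automatic structure for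
which moreover `L'_= = {(x,y)δᴿ : x ∈ L, y ∈ Pref(L), x = y in S}` is regular. -/
structure SgpPrefixAutoStruct {α β : Type*} (R : Set (List α × List α))
    (g : β → List α) (L : Set (List β)) extends SgpAutoStruct R g L : Prop where
  pre_reg : IsReg {p | ∃ x ∈ L, ∃ y : List β, (∃ z ∈ L, y <+: z) ∧
      WordEq R (expandW g x) (expandW g y) ∧ p = padR x y}

/-- A biautomatic structure for the semigroup `sgp⁺⟨α ∣ R⟩`: the languages
`L_b^$`, `_bL^$`, `^$L_b` and `_b^$L` are regular for every `b ∈ β ∪ {ε}`. -/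
structure SgpBiautoStruct {α β : Type*} (R : Set (List α × List α))
    (g : β → List α) (L : Set (List β)) : Prop where
  gen_ne : ∀ b, g b ≠ []
  reg : IsReg L
  ne : ∀ w ∈ L, w ≠ []
  onto : ∀ w : List α, w ≠ [] → ∃ x ∈ L, WordEq R (expandW g x) w
  eqR_reg : IsReg {p | ∃ x ∈ L, ∃ y ∈ L,
      WordEq R (expandW g x) (expandW g y) ∧ p = padR x y}
  eqL_reg : IsReg {p | ∃ x ∈ L, ∃ y ∈ L,
      WordEq R (expandW g x) (expandW g y) ∧ p = padL x y}
  mulRR_reg : ∀ b : β, IsReg {p | ∃ x ∈ L, ∃ y ∈ L,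
      WordEq R (expandW g x ++ g b) (expandW g y) ∧ p = padR x y}
  mulLR_reg : ∀ b : β, IsReg {p | ∃ x ∈ L, ∃ y ∈ L,
      WordEq R (g b ++ expandW g x) (expandW g y) ∧ p = padR x y}
  mulRL_reg : ∀ b : β, IsReg {p | ∃ x ∈ L, ∃ y ∈ L,
      WordEq R (expandW g x ++ g b) (expandW g y) ∧ p = padL x y}
  mulLL_reg : ∀ b : β, IsReg {p | ∃ x ∈ L, ∃ y ∈ L,
      WordEq R (g b ++ expandW g x) (expandW g y) ∧ p = padL x y}

/-- The semigroup `sgp⁺⟨α ∣ R⟩` is automatic: it admits an automatic structure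
over some finite generating set. -/
def SgpAutomatic {α : Type*} (R : Set (List α × List α)) : Prop :=
  ∃ (β : Type) (_ : Fintype β) (g : β → List α) (L : Set (List β)),
    SgpAutoStruct R g L

/-- The semigroup `sgp⁺⟨α ∣ R⟩` is prefix-automatic. -/
def SgpPrefixAutomatic {α : Type*} (R : Set (List α × List α)) : Prop :=
  ∃ (β : Type) (_ : Fintype β) (g : β → List α) (L : Set (List β)),
    SgpPrefixAutoStruct R g L

/-- The semigroup `sgp⁺⟨α ∣ R⟩` is biautomatic. -/
def SgpBiautomatic {α : Type*} (R : Set (List α × List α)) : Prop :=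
  ∃ (β : Type) (_ : Fintype β) (g : β → List α) (L : Set (List β)),
    SgpBiautoStruct R g L

/-- `(g, L)` is an automatic structure for the monoid `sgp⟨α ∣ R⟩` with respect
to a finite generating set indexed by `β`; generators may represent any element
of the monoid (in particular the identity, represented by the empty word). -/
structure MonAutoStruct {α β : Type*} (R : Set (List α × List α))
    (g : β → List α) (L : Set (List β)) : Prop where
  reg : IsReg L
  ne : ∀ w ∈ L, w ≠ []
  onto : ∀ w : List α, ∃ x ∈ L, WordEq R (expandW g x) w
  eq_reg : IsReg {p | ∃ x ∈ L, ∃ y ∈ L,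
      WordEq R (expandW g x) (expandW g y) ∧ p = padR x y}
  mul_reg : ∀ b : β, IsReg {p | ∃ x ∈ L, ∃ y ∈ L,
      WordEq R (expandW g x ++ g b) (expandW g y) ∧ p = padR x y}

/-- A prefix-automatic structure for the monoid `sgp⟨α ∣ R⟩`. -/
structure MonPrefixAutoStruct {α β : Type*} (R : Set (List α × List α))
    (g : β → List α) (L : Set (List β)) extends MonAutoStruct R g L : Prop where
  pre_reg : IsReg {p | ∃ x ∈ L, ∃ y : List β, (∃ z ∈ L, y <+: z) ∧
      WordEq R (expandW g x) (expandW g y) ∧ p = padR x y}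

/-- A biautomatic structure for the monoid `sgp⟨α ∣ R⟩`. -/
structure MonBiautoStruct {α β : Type*} (R : Set (List α × List α))
    (g : β → List α) (L : Set (List β)) : Prop where
  reg : IsReg L
  ne : ∀ w ∈ L, w ≠ []
  onto : ∀ w : List α, ∃ x ∈ L, WordEq R (expandW g x) w
  eqR_reg : IsReg {p | ∃ x ∈ L, ∃ y ∈ L,
      WordEq R (expandW g x) (expandW g y) ∧ p = padR x y}
  eqL_reg : IsReg {p | ∃ x ∈ L, ∃ y ∈ L,
      WordEq R (expandW g x) (expandW g y) ∧ p = padL x y}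
  mulRR_reg : ∀ b : β, IsReg {p | ∃ x ∈ L, ∃ y ∈ L,
      WordEq R (expandW g x ++ g b) (expandW g y) ∧ p = padR x y}
  mulLR_reg : ∀ b : β, IsReg {p | ∃ x ∈ L, ∃ y ∈ L,
      WordEq R (g b ++ expandW g x) (expandW g y) ∧ p = padR x y}
  mulRL_reg : ∀ b : β, IsReg {p | ∃ x ∈ L, ∃ y ∈ L,
      WordEq R (expandW g x ++ g b) (expandW g y) ∧ p = padL x y}
  mulLL_reg : ∀ b : β, IsReg {p | ∃ x ∈ L, ∃ y ∈ L,
      WordEq R (g b ++ expandW g x) (expandW g y) ∧ p = padL x y}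

/-- The monoid `sgp⟨α ∣ R⟩` is automatic. -/
def MonAutomatic {α : Type*} (R : Set (List α × List α)) : Prop :=
  ∃ (β : Type) (_ : Fintype β) (g : β → List α) (L : Set (List β)),
    MonAutoStruct R g L

/-- The monoid `sgp⟨α ∣ R⟩` is prefix-automatic. -/
def MonPrefixAutomatic {α : Type*} (R : Set (List α × List α)) : Prop :=
  ∃ (β : Type) (_ : Fintype β) (g : β → List α) (L : Set (List β)),
    MonPrefixAutoStruct R g L

/-- The monoid `sgp⟨α ∣ R⟩` is biautomatic. -/
def MonBiautomatic {α : Type*} (R : Set (List α × List α)) : Prop :=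
  ∃ (β : Type) (_ : Fintype β) (g : β → List α) (L : Set (List β)),
    MonBiautoStruct R g L

/-- The defining relations of `S¹ = sgp⁺⟨α, e ∣ R, ea = ae = a, ee = e⟩`,
the monoid obtained from `S = sgp⁺⟨α ∣ R⟩` by adjoining an identity element,
presented as a semigroup over the alphabet `Option α` where `none` is the new
identity letter `e`. -/
def adjoinOne {α : Type*} (R : Set (List α × List α)) :
    Set (List (Option α) × List (Option α)) :=
  {q | ∃ p ∈ R, q = (p.1.map some, p.2.map some)} ∪
    {q | ∃ a : α, q = ([none, some a], [some a])} ∪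
    {q | ∃ a : α, q = ([some a, none], [some a])} ∪
    {([none, none], [none])}


/-! ### Regular language toolkit -/

section RegTools

theorem reg_unfold {γ : Type} {L : Set (List γ)} (h : IsReg L) :
    ∃ (σ : Type) (_ : Fintype σ) (F : σ → Set (List γ)) (st : σ → γ → σ) (s₀ : σ),
      L = F s₀ ∧ ∀ q c w, c :: w ∈ F q ↔ w ∈ F (st q c) := by
  obtain ⟨σ, hσ, M, hM⟩ := h
  refine ⟨σ, hσ, fun q => M.acceptsFrom q, M.step, M.start, hM.symm, ?_⟩
  intro q c w
  rfl

theorem reg_of_nfs {γ ι : Type} [Fintype ι] (F : ι → Set (List γ))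
    (h : ∀ i c, ∃ T : Set ι, ∀ w, c :: w ∈ F i ↔ ∃ j ∈ T, w ∈ F j) (i : ι) : IsReg (F i) := by
  classical
  choose T hT using h
  let M : DFA γ (Set ι) :=
    { step := fun S c => {j | ∃ i ∈ S, j ∈ T i c}
      start := {i}
      accept := {S | ∃ i ∈ S, [] ∈ F i} }
  have key : ∀ w (S : Set ι), w ∈ M.acceptsFrom S ↔ ∃ i ∈ S, w ∈ F i := by
    intro w
    induction w with
    | nil => intro S; rfl
    | cons c w ih =>
      intro S
      have : c :: w ∈ M.acceptsFrom S ↔ w ∈ M.acceptsFrom (M.step S c) := Iff.rfl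
      rw [this, ih]
      constructor
      · rintro ⟨j, ⟨i, hi, hj⟩, hw⟩
        exact ⟨i, hi, (hT i c w).2 ⟨j, hj, hw⟩⟩
      · rintro ⟨i, hi, hw⟩
        obtain ⟨j, hj, hw⟩ := (hT i c w).1 hw
        exact ⟨j, ⟨i, hi, hj⟩, hw⟩
  refine ⟨Set ι, inferInstance, M, ?_⟩
  ext w
  refine (key w {i}).trans ?_
  exact ⟨fun ⟨j, hj, hw⟩ => by cases hj; exact hw, fun hw => ⟨i, rfl, hw⟩⟩

theorem reg_union {γ : Type} {L M : Set (List γ)} (h : IsReg L) (h' : IsReg M) :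
    IsReg (L ∪ M) := Language.IsRegular.add h h'

theorem reg_inter {γ : Type} {L M : Set (List γ)} (h : IsReg L) (h' : IsReg M) :
    IsReg (L ∩ M) := Language.IsRegular.inf h h'

theorem reg_compl {γ : Type} {L : Set (List γ)} (h : IsReg L) :
    IsReg Lᶜ := Language.IsRegular.compl h

theorem reg_rev {γ : Type} {L : Set (List γ)} (h : IsReg L) :
    IsReg {w | w.reverse ∈ L} := Language.IsRegular.reverse h

theorem reg_congr {γ : Type} {L M : Set (List γ)} (h : IsReg L) (e : ∀ w, w ∈ M ↔ w ∈ L) :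
    IsReg M := by
  have : M = L := Set.ext e
  rw [this]; exact h

/-- Concatenation of regular languages. -/
theorem reg_mul {γ : Type} {K L : Set (List γ)} (hK : IsReg K) (hL : IsReg L) :
    IsReg {w | ∃ x ∈ K, ∃ y ∈ L, w = x ++ y} := by
  obtain ⟨σ, _, F, st, s₀, rfl, hF⟩ := reg_unfold hK
  obtain ⟨τ, _, G, tt, t₀, rfl, hG⟩ := reg_unfold hL
  let H : σ ⊕ τ → Set (List γ) := fun i => match i with
    | .inl q => {w | ∃ x ∈ F q, ∃ y ∈ G t₀, w = x ++ y}
    | .inr t => G t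
  refine reg_of_nfs H ?_ (.inl s₀)
  rintro (q | t) c
  · refine ⟨{j | j = .inl (st q c) ∨ (j = .inr (tt t₀ c) ∧ [] ∈ F q)}, fun w => ?_⟩
    constructor
    · rintro ⟨x, hx, y, hy, e⟩
      cases x with
      | nil =>
        refine ⟨.inr (tt t₀ c), Or.inr ⟨rfl, hx⟩, ?_⟩
        refine (hG _ _ _).1 ?_
        simpa using e ▸ hy
      | cons d x =>
        simp only [List.cons_append, List.cons.injEq] at e
        obtain ⟨rfl, rfl⟩ := e
        exact ⟨.inl (st q c), Or.inl rfl, x, (hF _ _ _).1 hx, y, hy, rfl⟩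
    · rintro ⟨j, rfl | ⟨rfl, hq⟩, hw⟩
      · obtain ⟨x, hx, y, hy, rfl⟩ := hw
        exact ⟨c :: x, (hF _ _ _).2 hx, y, hy, rfl⟩
      · exact ⟨[], hq, c :: w, (hG _ _ _).2 hw, rfl⟩
  · refine ⟨{.inr (tt t c)}, fun w => ?_⟩
    constructor
    · intro hw
      exact ⟨_, rfl, (hG _ _ _).1 hw⟩
    · rintro ⟨_, rfl, hw⟩
      exact (hG _ _ _).2 hw

theorem reg_map {γ δ : Type} (f : γ → δ) {K : Set (List γ)} (hK : IsReg K) :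
    IsReg {w | ∃ k ∈ K, w = k.map f} := by
  obtain ⟨σ, _, F, st, s₀, rfl, hF⟩ := reg_unfold hK
  refine reg_of_nfs (fun q => {w | ∃ k ∈ F q, w = k.map f}) ?_ s₀
  intro q c
  refine ⟨{j | ∃ a, f a = c ∧ j = st q a}, fun w => ?_⟩
  constructor
  · rintro ⟨k, hk, e⟩
    cases k with
    | nil => simp at e
    | cons a k =>
      simp only [List.map_cons, List.cons.injEq] at e
      exact ⟨_, ⟨a, e.1.symm, rfl⟩, k, (hF _ _ _).1 hk, e.2⟩
  · rintro ⟨_, ⟨a, rfl, rfl⟩, k, hk, rfl⟩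
    exact ⟨a :: k, (hF _ _ _).2 hk, rfl⟩

theorem reg_filterMap {γ δ : Type} (f : γ → Option δ) {K : Set (List δ)} (hK : IsReg K) :
    IsReg {w | w.filterMap f ∈ K} := by
  obtain ⟨σ, _, F, st, s₀, rfl, hF⟩ := reg_unfold hK
  refine reg_of_nfs (fun q => {w | w.filterMap f ∈ F q}) ?_ s₀
  intro q c
  cases hc : f c with
  | none =>
    refine ⟨{q}, fun w => ?_⟩
    simp [hc]
  | some d =>
    refine ⟨{st q d}, fun w => ?_⟩
    simp [hc, hF]

theorem reg_letters {γ : Type} (P : γ → Prop) : IsReg {w : List γ | ∀ c ∈ w, P c} := by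
  refine reg_of_nfs (fun _ : Unit => {w : List γ | ∀ c ∈ w, P c}) ?_ ()
  intro _ c
  refine ⟨{_j | P c}, fun w => ?_⟩
  simp

theorem reg_nil {γ : Type} : IsReg {w : List γ | w = []} := by
  refine reg_congr (reg_letters (fun _ : γ => False)) fun w => ?_
  cases w with
  | nil => simp
  | cons c w =>
    simp only [Set.mem_ofPred_eq, reduceCtorEq, imp_false, false_iff]
    exact fun h => h c (by simp)

theorem reg_single {γ : Type} (f : List γ) : IsReg {w : List γ | w = f} := by
  induction f with
  | nil => exact reg_nil
  | cons c f ih =>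
    have h1 : IsReg {w : List γ | w = [c]} := by
      refine reg_of_nfs (fun b : Bool => {w : List γ | w = if b then [c] else []}) ?_ true
      rintro (_ | _) d
      · exact ⟨∅, fun w => by simp⟩
      · exact ⟨{_j | _j = false ∧ d = c}, fun w => by simp [and_comm]⟩
    exact reg_congr (reg_mul h1 ih) fun w => by simp

theorem reg_univ {γ : Type} : IsReg (Set.univ : Set (List γ)) :=
  reg_congr (reg_letters (fun _ => True)) (by simp)

/-- Powers of a two letter word. -/
theorem reg_star2 {γ : Type} (c d : γ) :
    IsReg {w : List γ | ∃ n : ℕ, w = (List.replicate n [c, d]).flatten} := by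
  refine reg_of_nfs (fun b : Bool => {w : List γ | ∃ n : ℕ, w =
    (if b then [] else [d]) ++ (List.replicate n [c, d]).flatten}) ?_ true
  rintro (_ | _) e
  · refine ⟨{j | j = true ∧ e = d}, fun w => ?_⟩
    simp [and_comm]
  · refine ⟨{j | j = false ∧ e = c}, fun w => ?_⟩
    constructor
    · rintro ⟨n, hn⟩
      cases n with
      | zero => simp at hn
      | succ n =>
        simp [List.replicate_succ] at hn
        exact ⟨false, ⟨rfl, hn.1⟩, n, by simp [hn.2]⟩
    · rintro ⟨_, ⟨rfl, rfl⟩, n, rfl⟩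
      exact ⟨n + 1, by simp [List.replicate_succ]⟩

/-- Words avoiding all the factors in `F`. -/
def Avoid {α : Type} (F : List (List α)) : Set (List α) := {w | ∀ f ∈ F, ¬ f <:+: w}

theorem reg_avoid {α : Type} (F : List (List α)) : IsReg (Avoid F) := by
  induction F with
  | nil => exact reg_congr reg_univ (by simp [Avoid])
  | cons f F ih =>
    have h := reg_compl (reg_mul (reg_mul (reg_univ (γ := α)) (reg_single f)) (reg_univ (γ := α)))
    refine reg_congr (reg_inter h ih) fun w => ?_
    simp only [Avoid, List.mem_cons, Set.mem_ofPred_eq, Set.mem_inter_iff, Set.mem_compl_iff,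
      forall_eq_or_imp]
    refine and_congr ?_ Iff.rfl
    refine not_congr ?_
    constructor
    · rintro ⟨s, t, rfl⟩
      exact ⟨s ++ f, ⟨s, trivial, f, rfl, rfl⟩, t, trivial, rfl⟩
    · rintro ⟨_, ⟨s, _, _, rfl, rfl⟩, t, _, rfl⟩
      exact ⟨s, t, rfl⟩

end RegTools

section Pad
variable {β : Type}

@[simp] theorem padR_nil_nil : padR ([] : List β) [] = [] := by simp [padR]
@[simp] theorem padR_cons_cons (a b : β) (x y : List β) :
    padR (a :: x) (b :: y) = (some a, some b) :: padR x y := by simp [padR]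
@[simp] theorem padR_cons_nil (a : β) (x : List β) :
    padR (a :: x) [] = (some a, none) :: padR x [] := by
  simp [padR, List.replicate_succ]
@[simp] theorem padR_nil_cons (b : β) (y : List β) :
    padR [] (b :: y) = (none, some b) :: padR [] y := by
  simp [padR, List.replicate_succ]

theorem padL_eq (x y : List β) : padL x y = (padR x.reverse y.reverse).reverse := by
  unfold padL padR
  change List.zipWith Prod.mk _ _ = (List.zipWith Prod.mk _ _).reverse
  rw [List.reverse_zipWith]
  · simp
  · simp; omega

theorem padR_eq (x y : List β) : padR x y = (padL x.reverse y.reverse).reverse := by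
  simp [padL_eq]

theorem padR_swap (x y : List β) : (padR x y).map Prod.swap = padR y x := by
  induction x generalizing y with
  | nil => induction y with
    | nil => simp
    | cons b y ih => simp [ih]
  | cons a x ih => cases y with
    | nil => simp [ih]
    | cons b y => simp [ih]

theorem padR_fst (x y : List β) : (padR x y).filterMap Prod.fst = x := by
  induction x generalizing y with
  | nil => induction y with
    | nil => simp
    | cons b y ih => simp [ih]
  | cons a x ih => cases y with
    | nil => simp [ih]
    | cons b y => simp [ih]

theorem padR_snd (x y : List β) : (padR x y).filterMap Prod.snd = y := by
  induction x generalizing y with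
  | nil => induction y with
    | nil => simp
    | cons b y ih => simp [ih]
  | cons a x ih => cases y with
    | nil => simp [ih]
    | cons b y => simp [ih]

theorem padL_fst (x y : List β) : (padL x y).filterMap Prod.fst = x := by
  rw [padL_eq, List.filterMap_reverse, padR_fst, List.reverse_reverse]

theorem padL_snd (x y : List β) : (padL x y).filterMap Prod.snd = y := by
  rw [padL_eq, List.filterMap_reverse, padR_snd, List.reverse_reverse]

/-- pair letters as padded letters -/
def up (c : β × β) : Option β × Option β := (some c.1, some c.2)

theorem padR_sync (k : List (β × β)) (x y : List β) :
    padR (k.map Prod.fst ++ x) (k.map Prod.snd ++ y) = k.map up ++ padR x y := by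
  induction k with
  | nil => simp
  | cons c k ih => simp [ih, up]

/-- `ρ` has a regular right-padded convolution. -/
def RR (ρ : List β → List β → Prop) : Prop := IsReg {z | ∃ x y, ρ x y ∧ z = padR x y}
/-- `ρ` has a regular left-padded convolution. -/
def RL (ρ : List β → List β → Prop) : Prop := IsReg {z | ∃ x y, ρ x y ∧ z = padL x y}

theorem RR.congr {ρ ρ' : List β → List β → Prop} (h : RR ρ) (e : ∀ x y, ρ' x y ↔ ρ x y) :
    RR ρ' := by
  have : ρ' = ρ := by funext x y; exact propext (e x y)
  rw [this]; exact h

theorem RR.union {ρ ρ' : List β → List β → Prop} (h : RR ρ) (h' : RR ρ') :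
    RR (fun x y => ρ x y ∨ ρ' x y) := by
  refine reg_congr (reg_union h h') fun w => ?_
  constructor
  · rintro ⟨x, y, h | h, e⟩
    · exact Or.inl ⟨x, y, h, e⟩
    · exact Or.inr ⟨x, y, h, e⟩
  · rintro (⟨x, y, h, e⟩ | ⟨x, y, h, e⟩)
    · exact ⟨x, y, Or.inl h, e⟩
    · exact ⟨x, y, Or.inr h, e⟩

theorem RL_iff (ρ : List β → List β → Prop) :
    RL ρ ↔ RR (fun x y => ρ x.reverse y.reverse) := by
  constructor
  · intro h
    refine reg_congr (reg_rev h) fun w => ?_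
    constructor
    · rintro ⟨x, y, h, rfl⟩
      exact ⟨_, _, h, by simp [padL_eq]⟩
    · rintro ⟨x, y, h, e⟩
      refine ⟨x.reverse, y.reverse, by simpa using h, ?_⟩
      rw [padL_eq] at e
      exact List.reverse_injective e
  · intro h
    refine reg_congr (reg_rev h) fun w => ?_
    constructor
    · rintro ⟨x, y, h, rfl⟩
      exact ⟨x.reverse, y.reverse, by simpa using h, by simp [padL_eq]⟩
    · rintro ⟨x, y, h, e⟩
      refine ⟨x.reverse, y.reverse, h, ?_⟩
      rw [padL_eq]
      simp [← e]

theorem RR.swap {ρ : List β → List β → Prop} (h : RR ρ) : RR (fun x y => ρ y x) := by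
  refine reg_congr (reg_map Prod.swap h) fun w => ?_
  constructor
  · rintro ⟨x, y, h, rfl⟩
    exact ⟨_, ⟨y, x, h, rfl⟩, (padR_swap _ _).symm⟩
  · rintro ⟨_, ⟨y, x, h, rfl⟩, rfl⟩
    exact ⟨x, y, h, padR_swap _ _⟩

/-- Delay the second track by one letter. -/
def sh : Option β → List (Option β × Option β) → List (Option β × Option β)
  | t, [] => match t with
    | none => []
    | some b => [(none, some b)]
  | t, c :: w => (c.1, t) :: sh c.2 w

theorem sh_padR_nil (x : List β) : sh none (padR x []) = padR x [] := by
  induction x with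
  | nil => simp [sh]
  | cons a x ih => simp [sh, ih]

theorem sh_padR (l : β) (x y : List β) : padR x (l :: y) = sh (some l) (padR x y) := by
  induction x generalizing y l with
  | nil => induction y generalizing l with
    | nil => simp [sh]
    | cons b y ih => simp only [padR_nil_cons, sh] at *; simp [← ih]
  | cons a x ih => cases y with
    | nil => simp [sh, sh_padR_nil]
    | cons b y => simp [sh, ih]

theorem reg_sh [Fintype β] {K : Set (List (Option β × Option β))} (hK : IsReg K)
    (t : Option β) : IsReg {w | ∃ k ∈ K, w = sh t k} := by
  obtain ⟨σ, _, F, st, s₀, rfl, hF⟩ := reg_unfold hK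
  let H : (σ × Option β) ⊕ Unit → Set (List (Option β × Option β)) := fun i => match i with
    | .inl q => {w | ∃ k ∈ F q.1, w = sh q.2 k}
    | .inr _ => {[]}
  refine reg_of_nfs H ?_ (.inl (s₀, t))
  rintro (⟨q, t⟩ | _) c
  · refine ⟨{j | (∃ t', j = .inl (st q (c.1, t'), t') ∧ c.2 = t) ∨
      (j = .inr () ∧ [] ∈ F q ∧ ∃ b, t = some b ∧ c = (none, some b))}, fun w => ?_⟩
    constructor
    · rintro ⟨k, hk, e⟩
      cases k with
      | nil =>
        cases t with
        | none => simp [sh] at e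
        | some b =>
          simp [sh] at e
          exact ⟨.inr (), Or.inr ⟨rfl, hk, b, rfl, e.1⟩, e.2⟩
      | cons d k =>
        simp [sh] at e
        obtain ⟨rfl, rfl⟩ := e
        exact ⟨_, Or.inl ⟨d.2, rfl, rfl⟩, k, (hF _ _ _).1 hk, rfl⟩
    · rintro ⟨j, ⟨t', rfl, rfl⟩ | ⟨rfl, hq, b, rfl, rfl⟩, hw⟩
      · obtain ⟨k, hk, rfl⟩ := hw
        exact ⟨(c.1, t') :: k, (hF _ _ _).2 hk, by simp [sh]⟩
      · cases hw
        exact ⟨[], hq, by simp [sh]⟩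
  · refine ⟨∅, fun w => ?_⟩
    simp [H]

theorem RR.shift [Fintype β] {ρ : List β → List β → Prop} (h : RR ρ) (l : β) :
    RR (fun x y => ∃ y', ρ x y' ∧ y = l :: y') := by
  refine reg_congr (reg_sh h (some l)) fun w => ?_
  constructor
  · rintro ⟨x, _, ⟨y, h, rfl⟩, rfl⟩
    exact ⟨_, ⟨x, y, h, rfl⟩, sh_padR _ _ _⟩
  · rintro ⟨_, ⟨x, y, h, rfl⟩, rfl⟩
    exact ⟨x, _, ⟨y, h, rfl⟩, (sh_padR _ _ _).symm⟩

theorem RR.shiftW [Fintype β] {ρ : List β → List β → Prop} (h : RR ρ) (p : List β) :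
    RR (fun x y => ∃ y', ρ x y' ∧ y = p ++ y') := by
  induction p with
  | nil => exact h.congr (by simp)
  | cons l p ih =>
    refine (ih.shift l).congr fun x y => ?_
    simp

theorem RR.shift2 [Fintype β] {ρ : List β → List β → Prop} (h : RR ρ) (p q : List β) :
    RR (fun x y => ∃ x' y', ρ x' y' ∧ x = p ++ x' ∧ y = q ++ y') := by
  refine ((h.shiftW q).swap.shiftW p).swap.congr fun x y => ?_
  constructor
  · rintro ⟨x', y', h, rfl, rfl⟩
    exact ⟨x', ⟨y', h, rfl⟩, rfl⟩
  · rintro ⟨x', ⟨y', h, rfl⟩, rfl⟩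
    exact ⟨x', y', h, rfl, rfl⟩

theorem RR.sync {ρ : List β → List β → Prop} (h : RR ρ) {K : Set (List (β × β))}
    (hK : IsReg K) : RR (fun x y => ∃ k ∈ K, ∃ x' y', ρ x' y' ∧ x = k.map Prod.fst ++ x' ∧
      y = k.map Prod.snd ++ y') := by
  refine reg_congr (reg_mul (reg_map up hK) h) fun w => ?_
  constructor
  · rintro ⟨_, _, ⟨k, hk, x, y, h, rfl, rfl⟩, rfl⟩
    exact ⟨_, ⟨k, hk, rfl⟩, _, ⟨x, y, h, rfl⟩, padR_sync _ _ _⟩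
  · rintro ⟨_, ⟨k, hk, rfl⟩, _, ⟨x, y, h, rfl⟩, rfl⟩
    exact ⟨_, _, ⟨k, hk, x, y, h, rfl, rfl⟩, (padR_sync _ _ _).symm⟩

/-- Two synchronous parts separated by a fixed replacement of `p` by `q`. -/
def Mid (K₁ : Set (List (β × β))) (p q : List β) (K₂ : Set (List (β × β)))
    (x y : List β) : Prop :=
  ∃ k₁ ∈ K₁, ∃ k₂ ∈ K₂, x = k₁.map Prod.fst ++ (p ++ k₂.map Prod.fst) ∧
    y = k₁.map Prod.snd ++ (q ++ k₂.map Prod.snd)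

theorem RR_mid [Fintype β] {K₁ K₂ : Set (List (β × β))} (h₁ : IsReg K₁) (h₂ : IsReg K₂)
    (p q : List β) : RR (Mid K₁ p q K₂) := by
  have h0 : RR (fun x y : List β => x = [] ∧ y = []) := by
    refine reg_congr reg_nil fun w => ?_
    simp
  refine (((h0.sync h₂).shift2 p q).sync h₁).congr fun x y => ?_
  constructor
  · rintro ⟨k₁, hk₁, k₂, hk₂, rfl, rfl⟩
    exact ⟨k₁, hk₁, _, _, ⟨_, _, ⟨k₂, hk₂, [], [], ⟨rfl, rfl⟩, rfl, rfl⟩, rfl, rfl⟩, by simp, by simp⟩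
  · rintro ⟨k₁, hk₁, _, _, ⟨_, _, ⟨k₂, hk₂, _, _, ⟨rfl, rfl⟩, rfl, rfl⟩, rfl, rfl⟩, rfl, rfl⟩
    exact ⟨k₁, hk₁, k₂, hk₂, by simp, by simp⟩

theorem mid_rev {K₁ K₂ : Set (List (β × β))} (p q x y : List β) :
    Mid K₁ p q K₂ x.reverse y.reverse ↔
      Mid {k | k.reverse ∈ K₂} p.reverse q.reverse {k | k.reverse ∈ K₁} x y := by
  constructor
  · rintro ⟨k₁, hk₁, k₂, hk₂, hx, hy⟩
    refine ⟨k₂.reverse, by simpa using hk₂, k₁.reverse, by simpa using hk₁, ?_, ?_⟩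
    · rw [← List.reverse_reverse x, hx]; simp
    · rw [← List.reverse_reverse y, hy]; simp
  · rintro ⟨k₁, hk₁, k₂, hk₂, rfl, rfl⟩
    exact ⟨k₂.reverse, hk₂, k₁.reverse, hk₁, by simp, by simp⟩

theorem RL_mid [Fintype β] {K₁ K₂ : Set (List (β × β))} (h₁ : IsReg K₁) (h₂ : IsReg K₂)
    (p q : List β) : RL (Mid K₁ p q K₂) := by
  rw [RL_iff]
  exact (RR_mid (reg_rev h₂) (reg_rev h₁) p.reverse q.reverse).congr fun x y => mid_rev p q x y

end Pad

section Words
variable {α : Type}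

theorem WordEq.refl (R : Set (List α × List α)) (x : List α) : WordEq R x x :=
  Relation.EqvGen.refl x
theorem WordEq.symm {R : Set (List α × List α)} {x y : List α} (h : WordEq R x y) :
    WordEq R y x := Relation.EqvGen.symm _ _ h
theorem WordEq.trans {R : Set (List α × List α)} {x y z : List α} (h : WordEq R x y)
    (h' : WordEq R y z) : WordEq R x z := Relation.EqvGen.trans _ _ _ h h'

theorem WordEq.lift {R : Set (List α × List α)} {τ : Type*} (f : List α → τ)
    (hf : ∀ x y, OneStep R x y → f x = f y) {x y : List α} (h : WordEq R x y) : f x = f y := by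
  induction h with
  | rel x y h => exact hf x y h
  | refl x => rfl
  | symm x y _ ih => exact ih.symm
  | trans x y z _ _ h1 h2 => exact h1.trans h2

theorem WordEq.map {R R' : Set (List α × List α)} (f : List α → List α)
    (hf : ∀ x y, OneStep R x y → WordEq R' (f x) (f y)) {x y : List α} (h : WordEq R x y) :
    WordEq R' (f x) (f y) := by
  induction h with
  | rel x y h => exact hf x y h
  | refl x => exact WordEq.refl _ _
  | symm x y _ ih => exact ih.symm
  | trans x y z _ _ h1 h2 => exact h1.trans h2

theorem WordEq.ctx {R : Set (List α × List α)} (p s : List α) {x y : List α}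
    (h : WordEq R x y) : WordEq R (p ++ x ++ s) (p ++ y ++ s) := by
  refine h.map (fun x => p ++ x ++ s) ?_
  rintro _ _ ⟨p', u, v, s', hR, rfl, rfl⟩
  exact Relation.EqvGen.rel _ _ ⟨p ++ p', u, v, s' ++ s, hR, by simp, by simp⟩

theorem WordEq.left {R : Set (List α × List α)} (p : List α) {x y : List α}
    (h : WordEq R x y) : WordEq R (p ++ x) (p ++ y) := by simpa using h.ctx p []

theorem WordEq.cons {R : Set (List α × List α)} (p : α) {x y : List α}
    (h : WordEq R x y) : WordEq R (p :: x) (p :: y) := h.left [p]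

theorem WordEq.right {R : Set (List α × List α)} (s : List α) {x y : List α}
    (h : WordEq R x y) : WordEq R (x ++ s) (y ++ s) := by simpa using h.ctx [] s

theorem WordEq.base (u v s : List α) : WordEq {(u, v)} (u ++ s) (v ++ s) :=
  Relation.EqvGen.rel _ _ ⟨[], u, v, s, rfl, by simp, by simp⟩

theorem WordEq.rev {u v : List α} {x y : List α} (h : WordEq {(u, v)} x y) :
    WordEq {(u.reverse, v.reverse)} x.reverse y.reverse := by
  refine h.map List.reverse ?_
  rintro _ _ ⟨p', u', v', s', hR, rfl, rfl⟩
  simp only [Set.mem_singleton_iff, Prod.mk.injEq] at hR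
  obtain ⟨rfl, rfl⟩ := hR
  exact Relation.EqvGen.rel _ _ ⟨s'.reverse, u'.reverse, v'.reverse, p'.reverse, rfl, by simp, by simp⟩

theorem WordEq.of_swap {u v : List α} {x y : List α} (h : WordEq {(u, v)} x y) :
    WordEq {(v, u)} x y := by
  refine h.map id ?_
  rintro _ _ ⟨p', u', v', s', hR, rfl, rfl⟩
  simp only [Set.mem_singleton_iff, Prod.mk.injEq] at hR
  obtain ⟨rfl, rfl⟩ := hR
  have h : OneStep {(v', u')} (p' ++ v' ++ s') (p' ++ u' ++ s') :=
    ⟨p', v', u', s', rfl, rfl, rfl⟩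
  exact Relation.EqvGen.symm _ _ (Relation.EqvGen.rel _ _ h)

/-- Embedding of words: a marker for the identity, then the word. -/
def E (x : List α) : List (Option α) := none :: x.map some

/-- generators -/
def gg (o : Option α) : List α := o.toList

theorem expand_E (x : List α) : expandW gg (E x) = x := by
  have : ∀ x : List α, expandW gg (x.map some) = x := by
    intro x
    induction x with
    | nil => rfl
    | cons a x ih => simp [expandW, gg] at ih ⊢; exact ih
  have h := this x
  simpa [E, expandW, gg] using h

theorem E_filter (x : List α) : (E x).filterMap id = x := by
  have : ∀ x : List α, (x.map some).filterMap id = x := by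
    intro x
    induction x with
    | nil => rfl
    | cons a x ih => simp
  simp [E]

def RRE (ρ : List α → List α → Prop) : Prop :=
  RR (fun X Y => ∃ x y, ρ x y ∧ X = E x ∧ Y = E y)
def RLE (ρ : List α → List α → Prop) : Prop :=
  RL (fun X Y => ∃ x y, ρ x y ∧ X = E x ∧ Y = E y)
def rv (ρ : List α → List α → Prop) (x y : List α) : Prop := ρ x.reverse y.reverse

def Nice (ρ : List α → List α → Prop) : Prop := RRE ρ ∧ RLE ρ ∧ RRE (rv ρ) ∧ RLE (rv ρ)

theorem rv_rv (ρ : List α → List α → Prop) : rv (rv ρ) = ρ := by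
  funext x y; simp [rv]

theorem Nice.rv {ρ : List α → List α → Prop} (h : Nice ρ) : Nice (rv ρ) :=
  ⟨h.2.2.1, h.2.2.2, by rw [rv_rv]; exact h.1, by rw [rv_rv]; exact h.2.1⟩

theorem or_E {ρ ρ' : List α → List α → Prop} (X Y : List (Option α)) :
    (∃ x y, (ρ x y ∨ ρ' x y) ∧ X = E x ∧ Y = E y) ↔
    (∃ x y, (ρ x y) ∧ X = E x ∧ Y = E y) ∨ (∃ x y, (ρ' x y) ∧ X = E x ∧ Y = E y) := by
  constructor
  · rintro ⟨x, y, h | h, e⟩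
    · exact Or.inl ⟨x, y, h, e⟩
    · exact Or.inr ⟨x, y, h, e⟩
  · rintro (⟨x, y, h, e⟩ | ⟨x, y, h, e⟩)
    · exact ⟨x, y, Or.inl h, e⟩
    · exact ⟨x, y, Or.inr h, e⟩

theorem RRE.or {ρ ρ' : List α → List α → Prop} (h : RRE ρ) (h' : RRE ρ') :
    RRE (fun x y => ρ x y ∨ ρ' x y) := (RR.union h h').congr or_E

theorem RLE.or {ρ ρ' : List α → List α → Prop} (h : RLE ρ) (h' : RLE ρ') :
    RLE (fun x y => ρ x y ∨ ρ' x y) := by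
  unfold RLE at *
  rw [RL_iff] at *
  exact (RR.union h h').congr fun X Y => or_E _ _

theorem Nice.or {ρ ρ' : List α → List α → Prop} (h : Nice ρ) (h' : Nice ρ') :
    Nice (fun x y => ρ x y ∨ ρ' x y) :=
  ⟨h.1.or h'.1, h.2.1.or h'.2.1, h.2.2.1.or h'.2.2.1, h.2.2.2.or h'.2.2.2⟩

def upE (c : α × α) : Option α × Option α := (some c.1, some c.2)

theorem mid_E (K₁ K₂ : Set (List (α × α))) (p q : List α) (X Y : List (Option α)) :
    (∃ x y, Mid K₁ p q K₂ x y ∧ X = E x ∧ Y = E y) ↔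
    Mid {k | ∃ k' ∈ {w | w = [(none, none)]}, ∃ k'' ∈ {w | ∃ k ∈ K₁, w = k.map upE}, k = k' ++ k''}
      (p.map some) (q.map some) {w | ∃ k ∈ K₂, w = k.map upE} X Y := by
  have e1 : ∀ k : List (α × α), (k.map upE).map Prod.fst = (k.map Prod.fst).map some := by
    intro k; rw [List.map_map, List.map_map]; rfl
  have e2 : ∀ k : List (α × α), (k.map upE).map Prod.snd = (k.map Prod.snd).map some := by
    intro k; rw [List.map_map, List.map_map]; rfl
  constructor
  · rintro ⟨_, _, ⟨k₁, hk₁, k₂, hk₂, rfl, rfl⟩, rfl, rfl⟩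
    refine ⟨_, ⟨_, rfl, _, ⟨k₁, hk₁, rfl⟩, rfl⟩, _, ⟨k₂, hk₂, rfl⟩, ?_, ?_⟩
    · simp only [E, List.map_append, List.map_cons, List.map_nil, e1, e2, List.cons_append, List.nil_append]
    · simp only [E, List.map_append, List.map_cons, List.map_nil, e1, e2, List.cons_append, List.nil_append]
  · rintro ⟨_, ⟨_, rfl, _, ⟨k₁, hk₁, rfl⟩, rfl⟩, _, ⟨k₂, hk₂, rfl⟩, rfl, rfl⟩
    refine ⟨_, _, ⟨k₁, hk₁, k₂, hk₂, rfl, rfl⟩, ?_, ?_⟩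
    · simp only [E, List.map_append, List.map_cons, List.map_nil, e1, e2, List.cons_append, List.nil_append]
    · simp only [E, List.map_append, List.map_cons, List.map_nil, e1, e2, List.cons_append, List.nil_append]

theorem RRE_mid [Fintype α] {K₁ K₂ : Set (List (α × α))} (h₁ : IsReg K₁) (h₂ : IsReg K₂)
    (p q : List α) : RRE (Mid K₁ p q K₂) :=
  (RR_mid (reg_mul (reg_single _) (reg_map upE h₁)) (reg_map upE h₂) _ _).congr (mid_E K₁ K₂ p q)

theorem RLE_mid [Fintype α] {K₁ K₂ : Set (List (α × α))} (h₁ : IsReg K₁) (h₂ : IsReg K₂)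
    (p q : List α) : RLE (Mid K₁ p q K₂) := by
  have := (RL_mid (reg_mul (reg_single [(none, none)]) (reg_map upE h₁)) (reg_map upE h₂)
    (p.map some) (q.map some))
  unfold RLE
  rw [RL_iff] at *
  exact this.congr fun X Y => mid_E K₁ K₂ p q _ _

theorem Nice_mid [Fintype α] {K₁ K₂ : Set (List (α × α))} (h₁ : IsReg K₁) (h₂ : IsReg K₂)
    (p q : List α) : Nice (Mid K₁ p q K₂) := by
  have e : rv (Mid K₁ p q K₂) =
      Mid {k | k.reverse ∈ K₂} p.reverse q.reverse {k | k.reverse ∈ K₁} := by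
    funext x y
    exact propext (mid_rev p q x y)
  refine ⟨RRE_mid h₁ h₂ p q, RLE_mid h₁ h₂ p q, ?_, ?_⟩
  · rw [e]; exact RRE_mid (reg_rev h₂) (reg_rev h₁) _ _
  · rw [e]; exact RLE_mid (reg_rev h₂) (reg_rev h₁) _ _

/-- diagonal words -/
def Dg : Set (List (α × α)) := {k | ∀ c ∈ k, c.1 = c.2}
theorem reg_Dg : IsReg (Dg (α := α)) := reg_letters _

theorem Dg_eq {k : List (α × α)} (h : k ∈ Dg) : k.map Prod.fst = k.map Prod.snd :=
  List.map_congr_left h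

theorem Dg_mk (x : List α) : ∃ k ∈ Dg (α := α), k.map Prod.fst = x ∧ k.map Prod.snd = x :=
  by
  refine ⟨x.map fun a => (a, a), ?_, ?_, ?_⟩
  · intro c hc
    obtain ⟨a, _, rfl⟩ := List.mem_map.1 hc
    rfl
  · rw [List.map_map]; exact List.map_id x
  · rw [List.map_map]; exact List.map_id x

/-- Mid with a diagonal right part -/
def MD (K : Set (List (α × α))) (p q x y : List α) : Prop :=
  ∃ k ∈ K, ∃ w, x = k.map Prod.fst ++ (p ++ w) ∧ y = k.map Prod.snd ++ (q ++ w)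

theorem Nice_MD [Fintype α] {K : Set (List (α × α))} (h : IsReg K) (p q : List α) :
    Nice (MD K p q) := by
  have : MD K p q = Mid K p q Dg := by
    funext x y
    apply propext
    constructor
    · rintro ⟨k, hk, w, rfl, rfl⟩
      obtain ⟨k', hk', e1, e2⟩ := Dg_mk w
      exact ⟨k, hk, k', hk', by rw [e1], by rw [e2]⟩
    · rintro ⟨k, hk, k', hk', rfl, rfl⟩
      exact ⟨k, hk, _, rfl, by rw [Dg_eq hk']⟩
  rw [this]
  exact Nice_mid h reg_Dg p q

/-- replace prefix -/
def PP (p q x y : List α) : Prop := ∃ w, x = p ++ w ∧ y = q ++ w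

theorem Nice_PP [Fintype α] (p q : List α) : Nice (PP p q) := by
  have : PP p q = MD {k | k = []} p q := by
    funext x y
    simp [PP, MD]
  rw [this]
  exact Nice_MD reg_nil p q

/-- Multiplication relation witness. -/
def Good (R : Set (List α × List α)) (Red : Set (List α))
    (Q : (List α → List α → Prop) → Prop) (T : List α → List α) : Prop :=
  ∃ ρ, Q ρ ∧ (∀ x y, ρ x y → WordEq R (T x) y) ∧ ∀ x ∈ Red, ∃ y ∈ Red, ρ x y

def Uniq (R : Set (List α × List α)) (Red : Set (List α)) : Prop :=
  ∀ x ∈ Red, ∀ y ∈ Red, WordEq R x y → x = y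

/-- The language. -/
def LL (Red : Set (List α)) : Set (List (Option α)) := {X | ∃ x ∈ Red, X = E x}

theorem reg_LL {Red : Set (List α)} (h : IsReg Red) : IsReg (LL Red) := by
  refine reg_congr (reg_mul (reg_single [none]) (reg_map some h)) fun w => ?_
  constructor
  · rintro ⟨x, hx, rfl⟩
    exact ⟨_, rfl, _, ⟨x, hx, rfl⟩, rfl⟩
  · rintro ⟨_, rfl, _, ⟨x, hx, rfl⟩, rfl⟩
    exact ⟨x, hx, rfl⟩

theorem reg_track {Red : Set (List α)} (h : IsReg Red)
    (f : Option (Option α) × Option (Option α) → Option (Option α)) :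
    IsReg {z : List (Option (Option α) × Option (Option α)) |
      (z.filterMap f).filterMap id ∈ Red} :=
  reg_filterMap f (reg_filterMap id h)

theorem Good.iff {R : Set (List α × List α)} {Red : Set (List α)}
    {ρ : List α → List α → Prop} {T : List α → List α} (hu : Uniq R Red)
    (h1 : ∀ x y, ρ x y → WordEq R (T x) y) (h2 : ∀ x ∈ Red, ∃ y ∈ Red, ρ x y)
    {x y : List α} (hx : x ∈ Red) (hy : y ∈ Red) : WordEq R (T x) y ↔ ρ x y := by
  constructor
  · intro h
    obtain ⟨y', hy', h'⟩ := h2 x hx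
    have : y = y' := hu y hy y' hy' (h.symm.trans (h1 _ _ h'))
    rw [this]; exact h'
  · exact h1 x y

theorem Good.regR {R : Set (List α × List α)} {Red : Set (List α)} {T : List α → List α}
    (hu : Uniq R Red) (hr : IsReg Red) (h : Good R Red RRE T) :
    IsReg {p | ∃ X ∈ LL Red, ∃ Y ∈ LL Red, WordEq R (T (expandW gg X)) (expandW gg Y) ∧
      p = padR X Y} := by
  obtain ⟨ρ, hq, h1, h2⟩ := h
  refine reg_congr (reg_inter hq (reg_inter (reg_track hr Prod.fst) (reg_track hr Prod.snd)))
    fun z => ?_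
  constructor
  · rintro ⟨_, ⟨x, hx, rfl⟩, _, ⟨y, hy, rfl⟩, he, rfl⟩
    rw [expand_E, expand_E] at he
    refine ⟨⟨_, _, ⟨x, y, (Good.iff hu h1 h2 hx hy).1 he, rfl, rfl⟩, rfl⟩, ?_, ?_⟩
    · simp only [Set.mem_ofPred_eq, padR_fst, E_filter]; exact hx
    · simp only [Set.mem_ofPred_eq, padR_snd, E_filter]; exact hy
  · rintro ⟨⟨_, _, ⟨x, y, he, rfl, rfl⟩, rfl⟩, hx, hy⟩
    simp only [Set.mem_ofPred_eq, padR_fst, padR_snd, E_filter] at hx hy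
    exact ⟨_, ⟨x, hx, rfl⟩, _, ⟨y, hy, rfl⟩, by rw [expand_E, expand_E]; exact h1 _ _ he, rfl⟩

theorem Good.regL {R : Set (List α × List α)} {Red : Set (List α)} {T : List α → List α}
    (hu : Uniq R Red) (hr : IsReg Red) (h : Good R Red RLE T) :
    IsReg {p | ∃ X ∈ LL Red, ∃ Y ∈ LL Red, WordEq R (T (expandW gg X)) (expandW gg Y) ∧
      p = padL X Y} := by
  obtain ⟨ρ, hq, h1, h2⟩ := h
  refine reg_congr (reg_inter hq (reg_inter (reg_track hr Prod.fst) (reg_track hr Prod.snd)))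
    fun z => ?_
  constructor
  · rintro ⟨_, ⟨x, hx, rfl⟩, _, ⟨y, hy, rfl⟩, he, rfl⟩
    rw [expand_E, expand_E] at he
    refine ⟨⟨_, _, ⟨x, y, (Good.iff hu h1 h2 hx hy).1 he, rfl, rfl⟩, rfl⟩, ?_, ?_⟩
    · simp only [Set.mem_ofPred_eq, padL_fst, E_filter]; exact hx
    · simp only [Set.mem_ofPred_eq, padL_snd, E_filter]; exact hy
  · rintro ⟨⟨_, _, ⟨x, y, he, rfl, rfl⟩, rfl⟩, hx, hy⟩
    simp only [Set.mem_ofPred_eq, padL_fst, padL_snd, E_filter] at hx hy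
    exact ⟨_, ⟨x, hx, rfl⟩, _, ⟨y, hy, rfl⟩, by rw [expand_E, expand_E]; exact h1 _ _ he, rfl⟩

theorem Good.mono {R : Set (List α × List α)} {Red : Set (List α)} {T : List α → List α}
    {Q Q' : (List α → List α → Prop) → Prop} (hQ : ∀ ρ, Q ρ → Q' ρ) (h : Good R Red Q T) :
    Good R Red Q' T := by
  obtain ⟨ρ, hq, h⟩ := h
  exact ⟨ρ, hQ _ hq, h⟩

theorem Good_id [Fintype α] (R : Set (List α × List α)) (Red : Set (List α)) :
    Good R Red Nice id := by
  refine ⟨_, Nice_PP [] [], ?_, ?_⟩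
  · rintro x y ⟨w, rfl, rfl⟩
    exact WordEq.refl _ _
  · intro x hx
    exact ⟨x, hx, x, rfl, rfl⟩

theorem onto_of {R : Set (List α × List α)} {Red : Set (List α)} (h0 : [] ∈ Red)
    (hr : ∀ l, Good R Red RRE (fun x => x ++ [l])) (w : List α) :
    ∃ X ∈ LL Red, WordEq R (expandW gg X) w := by
  suffices h : ∃ x ∈ Red, WordEq R x w by
    obtain ⟨x, hx, h⟩ := h
    exact ⟨E x, ⟨x, hx, rfl⟩, by rw [expand_E]; exact h⟩
  induction w using List.reverseRecOn with
  | nil => exact ⟨[], h0, WordEq.refl _ _⟩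
  | append_singleton w l ih =>
    obtain ⟨x, hx, h⟩ := ih
    obtain ⟨ρ, -, h1, h2⟩ := hr l
    obtain ⟨y, hy, hxy⟩ := h2 x hx
    exact ⟨y, hy, (h1 _ _ hxy).symm.trans (h.right [l])⟩

theorem nil_avoid {F : List (List α)} (h : [] ∉ F) : [] ∈ Avoid F := by
  intro f hf hh
  have : f = [] := by simpa using hh
  exact h (this ▸ hf)

theorem prefix_of [Fintype α] {R : Set (List α × List α)} {F : List (List α)} (hF : [] ∉ F)
    (hu : Uniq R (Avoid F)) (hr : ∀ l, Good R (Avoid F) RRE (fun x => x ++ [l])) :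
    MonPrefixAutomatic R := by
  have hreg := reg_avoid F
  have heq := (Good_id R (Avoid F)).mono (Q' := RRE) (fun ρ h => h.1)
  have hE := heq.regR hu hreg
  refine ⟨Option α, inferInstance, gg, LL (Avoid F), ⟨⟨reg_LL hreg, ?_, ?_, hE, ?_⟩, ?_⟩⟩
  · rintro _ ⟨x, _, rfl⟩
    simp [E]
  · exact onto_of (nil_avoid hF) hr
  · rintro (_ | l)
    · simpa [gg] using hE
    · exact (hr l).regR hu hreg
  · refine reg_congr (reg_union hE (reg_single (padR (E ([] : List α)) []))) fun z => ?_
    constructor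
    · rintro ⟨_, ⟨x, hx, rfl⟩, Y, ⟨_, ⟨y, hy, rfl⟩, hp⟩, he, rfl⟩
      cases Y with
      | nil =>
        right
        have : x = [] := hu x hx [] (nil_avoid hF) (by rw [expand_E] at he; exact he)
        rw [this]; rfl
      | cons o Y =>
        left
        simp only [E, List.cons_prefix_cons] at hp
        obtain ⟨rfl, hp⟩ := hp
        rw [List.prefix_iff_eq_take] at hp
        refine ⟨_, ⟨x, hx, rfl⟩, none :: Y, ⟨y.take Y.length, ?_, ?_⟩, he, rfl⟩
        · intro f hf hh
          exact hy f hf (hh.trans ⟨[], y.drop Y.length, by simp⟩)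
        · rw [hp]; simp [E]
    · rintro (⟨X, hX, Y, hY, he, rfl⟩ | rfl)
      · exact ⟨X, hX, Y, ⟨Y, hY, List.prefix_refl _⟩, he, rfl⟩
      · exact ⟨E [], ⟨[], nil_avoid hF, rfl⟩, [], ⟨E [], ⟨[], nil_avoid hF, rfl⟩, by simp⟩,
          by rw [expand_E]; exact WordEq.refl _ _, rfl⟩

theorem bi_of [Fintype α] {R : Set (List α × List α)} {F : List (List α)} (hF : [] ∉ F)
    (hu : Uniq R (Avoid F)) (hr : ∀ l, Good R (Avoid F) Nice (fun x => x ++ [l]))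
    (hl : ∀ l, Good R (Avoid F) Nice (fun x => [l] ++ x)) :
    MonBiautomatic R := by
  have hreg := reg_avoid F
  have hE := ((Good_id R (Avoid F)).mono (Q' := RRE) (fun ρ h => h.1)).regR hu hreg
  have hE' := ((Good_id R (Avoid F)).mono (Q' := RLE) (fun ρ h => h.2.1)).regL hu hreg
  refine ⟨Option α, inferInstance, gg, LL (Avoid F), ⟨reg_LL hreg, ?_, ?_, hE, hE', ?_, ?_, ?_, ?_⟩⟩
  · rintro _ ⟨x, _, rfl⟩
    simp [E]
  · exact onto_of (nil_avoid hF) (fun l => (hr l).mono fun ρ h => h.1)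
  · rintro (_ | l)
    · simpa [gg] using hE
    · exact ((hr l).mono (Q' := RRE) fun ρ h => h.1).regR hu hreg
  · rintro (_ | l)
    · simpa [gg] using hE
    · exact ((hl l).mono (Q' := RRE) fun ρ h => h.1).regR hu hreg
  · rintro (_ | l)
    · simpa [gg] using hE'
    · exact ((hr l).mono (Q' := RLE) fun ρ h => h.2.1).regL hu hreg
  · rintro (_ | l)
    · simpa [gg] using hE'
    · exact ((hl l).mono (Q' := RLE) fun ρ h => h.2.1).regL hu hreg

/-! duality -/

theorem inf_rev {x y : List α} (h : x <:+: y) : x.reverse <:+: y.reverse := by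
  obtain ⟨s, t, rfl⟩ := h
  exact ⟨t.reverse, s.reverse, by simp⟩

theorem avoid_rev {F : List (List α)} {x : List α} :
    x.reverse ∈ Avoid (F.map List.reverse) ↔ x ∈ Avoid F := by
  constructor
  · intro h f hf hh
    exact h f.reverse (List.mem_map_of_mem hf) (inf_rev hh)
  · intro h f hf hh
    obtain ⟨f, hf', rfl⟩ := List.mem_map.1 hf
    exact h f hf' (by simpa using inf_rev hh)

theorem Good.dual {u v u' v' : List α} {F F' : List (List α)}
    {Q Q' : (List α → List α → Prop) → Prop}
    (hQ : ∀ ρ, Q ρ → Q' (_root_.rv ρ)) {l : α}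
    (hu : u' = u.reverse) (hv : v' = v.reverse) (hF : F' = F.map List.reverse)
    (h : Good {(u', v')} (Avoid F') Q (fun x => [l] ++ x)) :
    Good {(u, v)} (Avoid F) Q' (fun x => x ++ [l]) := by
  subst hu hv hF
  obtain ⟨ρ, hq, h1, h2⟩ := h
  refine ⟨_root_.rv ρ, hQ _ hq, ?_, ?_⟩
  · intro x y hxy
    simpa using (h1 _ _ hxy).rev
  · intro x hx
    obtain ⟨y, hy, hxy⟩ := h2 _ (avoid_rev.2 hx)
    refine ⟨y.reverse, ?_, by simpa [_root_.rv] using hxy⟩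
    rw [← avoid_rev]; simpa using hy

theorem Uniq.dual {u v u' v' : List α} {F F' : List (List α)}
    (hu : u' = u.reverse) (hv : v' = v.reverse) (hF : F' = F.map List.reverse)
    (h : Uniq {(u', v')} (Avoid F')) : Uniq {(u, v)} (Avoid F) := by
  subst hu hv hF
  intro x hx y hy he
  exact List.reverse_injective (h _ (avoid_rev.2 hx) _ (avoid_rev.2 hy) he.rev)

theorem avoid_tail {F : List (List α)} {l : α} {w : List α} (h : l :: w ∈ Avoid F) :
    w ∈ Avoid F := fun f hf hh => h f hf (hh.trans (List.suffix_cons _ _).isInfix)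

/-- uniqueness of normal forms from a left action -/
theorem uniq_of {u v : List α} {F : List (List α)} (hF : [] ∉ F) (lm : α → List α → List α)
    (hRed : ∀ l, ∀ x ∈ Avoid F, lm l x ∈ Avoid F)
    (hrel : ∀ x ∈ Avoid F, u.foldr lm x = v.foldr lm x)
    (hcons : ∀ l w, l :: w ∈ Avoid F → lm l w = l :: w) : Uniq {(u, v)} (Avoid F) := by
  have hf : ∀ x : List α, x.foldr lm [] ∈ Avoid F := by
    intro x
    induction x with
    | nil => exact nil_avoid hF
    | cons l x ih => exact hRed _ _ ih
  have hn : ∀ x ∈ Avoid F, x.foldr lm [] = x := by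
    intro x
    induction x with
    | nil => intro _; rfl
    | cons l x ih =>
      intro h
      rw [List.foldr_cons, ih (avoid_tail h), hcons _ _ h]
  intro x hx y hy he
  rw [← hn x hx, ← hn y hy]
  refine he.lift (fun x => x.foldr lm []) ?_
  rintro _ _ ⟨p, u', v', s, hR, rfl, rfl⟩
  simp only [Set.mem_singleton_iff, Prod.mk.injEq] at hR
  obtain ⟨rfl, rfl⟩ := hR
  simp only [List.foldr_append]
  rw [hrel _ (hf s)]

end Words

section Cases
variable {α : Type}

theorem good_of {R : Set (List α × List α)} {Red : Set (List α)} (l : α) (f : List α → List α)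
    (hRed : ∀ x ∈ Red, f x ∈ Red) (Q : (List α → List α → Prop) → Prop)
    (ρ : List α → List α → Prop) (hQ : Q (fun x y => PP [] [l] x y ∨ ρ x y))
    (hs : ∀ x y, ρ x y → WordEq R (l :: x) y)
    (hc : ∀ x ∈ Red, f x = l :: x ∨ ρ x (f x)) : Good R Red Q (fun x => [l] ++ x) := by
  refine ⟨_, hQ, ?_, ?_⟩
  · rintro x y (⟨w, rfl, rfl⟩ | h)
    · exact WordEq.refl _ _
    · exact hs x y h
  · intro x hx
    refine ⟨f x, hRed x hx, ?_⟩
    rcases hc x hx with h | h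
    · left
      exact ⟨x, rfl, by rw [h]; rfl⟩
    · right; exact h

theorem good_triv [Fintype α] {R : Set (List α × List α)} {Red : Set (List α)} (l : α)
    (hRed : ∀ x ∈ Red, l :: x ∈ Red) : Good R Red Nice (fun x => [l] ++ x) := by
  refine ⟨_, Nice_PP [] [l], ?_, ?_⟩
  · rintro x y ⟨w, rfl, rfl⟩
    exact WordEq.refl _ _
  · intro x hx
    exact ⟨_, hRed x hx, x, rfl, rfl⟩

theorem av1 {c l : α} {w : List α} :
    l :: w ∈ Avoid [[c]] ↔ l ≠ c ∧ w ∈ Avoid [[c]] := by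
  simp [Avoid, List.infix_cons_iff, eq_comm]

theorem pre1 {b : α} {w : List α} : [b] <+: w ↔ w.head? = some b := by
  cases w <;> simp [eq_comm]

theorem av2 {a b l : α} {w : List α} :
    l :: w ∈ Avoid [[a, b]] ↔ ¬ (l = a ∧ w.head? = some b) ∧ w ∈ Avoid [[a, b]] := by
  simp [Avoid, List.infix_cons_iff, pre1, eq_comm]

theorem av23 {a b c l : α} {w : List α} :
    l :: w ∈ Avoid [[a, a], [a, b, c]] ↔ ¬ (l = a ∧ w.head? = some a) ∧
      ¬ (l = a ∧ w.head? = some b ∧ w.tail.head? = some c) ∧ w ∈ Avoid [[a, a], [a, b, c]] := by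
  cases w with
  | nil => simp [Avoid, List.infix_cons_iff]
  | cons m w =>
    simp [Avoid, List.infix_cons_iff, pre1]
    grind

theorem av23' {a b l : α} {w : List α} :
    l :: w ∈ Avoid [[a, a], [b, b, a]] ↔ ¬ (l = a ∧ w.head? = some a) ∧
      ¬ (l = b ∧ w.head? = some b ∧ w.tail.head? = some a) ∧ w ∈ Avoid [[a, a], [b, b, a]] := by
  cases w with
  | nil => simp [Avoid, List.infix_cons_iff]
  | cons m w =>
    simp [Avoid, List.infix_cons_iff, pre1]
    grind

theorem avnil {F : List (List α)} (h : [] ∉ F) : [] ∈ Avoid F := nil_avoid h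

open Classical in
/-- left multiplication by `l`, rule at the front only -/
noncomputable def lmF (a b : α) (t : List α) (l : α) (w : List α) : List α :=
  if l = a ∧ w.head? = some b then t ++ w.tail else l :: w

theorem lmF_cons {a b l : α} {t w : List α} (h : l :: w ∈ Avoid [[a, b]]) :
    lmF a b t l w = l :: w := by
  rw [av2] at h
  simp [lmF, h.1]

theorem lmF_good [Fintype α] {a b : α} {t : List α}
    (hRed : ∀ l, ∀ x ∈ Avoid [[a, b]], lmF a b t l x ∈ Avoid [[a, b]]) (l : α) :
    Good {([a, b], t)} (Avoid [[a, b]]) Nice (fun x => [l] ++ x) := by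
  by_cases hl : l = a
  · subst hl
    refine good_of l (lmF l b t l) (hRed l) Nice (PP [b] t) ((Nice_PP _ _).or (Nice_PP _ _)) ?_ ?_
    · rintro x y ⟨w, rfl, rfl⟩
      exact WordEq.base [l, b] t w
    · intro x hx
      by_cases h : x.head? = some b
      · right
        cases x with
        | nil => simp at h
        | cons m x =>
          simp at h; subst h
          exact ⟨x, rfl, by simp [lmF]⟩
      · left; simp [lmF, h]
  · refine good_triv l fun x hx => ?_
    rw [av2]; exact ⟨fun h => hl h.1, hx⟩

/-- `ab → ε` -/
theorem red_L1 {a b : α} : ∀ l, ∀ x ∈ Avoid [[a, b]], lmF a b [] l x ∈ Avoid [[a, b]] := by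
  intro l x hx
  unfold lmF
  split_ifs with h
  · cases x with
    | nil => exact hx
    | cons m x => exact avoid_tail hx
  · rw [av2]; exact ⟨h, hx⟩

theorem uniq_L1 (a b : α) : Uniq {([a, b], [])} (Avoid [[a, b]]) := by
  refine uniq_of (by simp) (lmF a b []) red_L1 ?_ fun l w h => lmF_cons h
  intro x hx
  simp only [List.foldr_cons, List.foldr_nil]
  by_cases h : b = a ∧ x.head? = some b
  · obtain ⟨rfl, h⟩ := h
    cases x with
    | nil => simp at h
    | cons m x =>
      simp at h; subst h
      have e : lmF m m [] m (m :: x) = x := by simp [lmF]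
      rw [e]
      exact lmF_cons hx
  · have e : lmF a b [] b x = b :: x := by simp [lmF, h]
    rw [e]; simp [lmF]

/-- `ab → b` -/
theorem red_L2 {a b : α} : ∀ l, ∀ x ∈ Avoid [[a, b]], lmF a b [b] l x ∈ Avoid [[a, b]] := by
  intro l x hx
  unfold lmF
  split_ifs with h
  · cases x with
    | nil => simp at h
    | cons m x =>
      simp at h; obtain ⟨-, rfl⟩ := h
      exact hx
  · rw [av2]; exact ⟨h, hx⟩

theorem uniq_L2 (a b : α) : Uniq {([a, b], [b])} (Avoid [[a, b]]) := by
  refine uniq_of (by simp) (lmF a b [b]) red_L2 ?_ fun l w h => lmF_cons h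
  intro x hx
  simp only [List.foldr_cons, List.foldr_nil]
  by_cases h : b = a ∧ x.head? = some b
  · obtain ⟨rfl, h⟩ := h
    cases x with
    | nil => simp at h
    | cons m x =>
      simp at h; subst h
      have e : lmF m m [m] m (m :: x) = m :: x := by simp [lmF]
      rw [e, e]
  · have e : lmF a b [b] b x = b :: x := by simp [lmF, h]
    rw [e]; simp [lmF]

/-- `ab → cd`, `d ≠ a` -/
theorem red_L4a {a b c d : α} (hcd : ¬ (c = a ∧ d = b)) (hd : d ≠ a) :
    ∀ l, ∀ x ∈ Avoid [[a, b]], lmF a b [c, d] l x ∈ Avoid [[a, b]] := by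
  intro l x hx
  unfold lmF
  split_ifs with h
  · cases x with
    | nil => simp at h
    | cons m x =>
      simp only [List.cons_append, List.nil_append, List.tail_cons]
      rw [av2, av2]
      exact ⟨by simpa using hcd, fun h => hd h.1, avoid_tail hx⟩
  · rw [av2]; exact ⟨h, hx⟩

theorem uniq_L4a {a b c d : α} (hab : a ≠ b) (hcd : ¬ (c = a ∧ d = b)) (hd : d ≠ a) :
    Uniq {([a, b], [c, d])} (Avoid [[a, b]]) := by
  refine uniq_of (by simp) (lmF a b [c, d]) (red_L4a hcd hd) ?_ fun l w h => lmF_cons h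
  intro x hx
  simp only [List.foldr_cons, List.foldr_nil]
  have e : lmF a b [c, d] b x = b :: x := by simp [lmF, hab.symm]
  have e' : lmF a b [c, d] d x = d :: x := by simp [lmF, hd]
  rw [e, e']
  have : ¬ (c = a ∧ (d :: x).head? = some b) := by simpa using hcd
  rw [lmF, lmF, if_neg this]
  simp

open Classical in
/-- `a b^n w ↦ c^n a w` -/
noncomputable def f4 (a b c : α) : List α → List α
  | [] => [a]
  | m :: w => if m = b then c :: f4 a b c w else a :: m :: w

theorem f4_head (a b c : α) (w : List α) :
    (f4 a b c w).head? = some a ∨ (f4 a b c w).head? = some c := by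
  cases w with
  | nil => simp [f4]
  | cons m w => unfold f4; split_ifs <;> simp

theorem f4_red {a b c : α} (hab : a ≠ b) : ∀ x ∈ Avoid [[a, b]], f4 a b c x ∈ Avoid [[a, b]] := by
  intro x
  induction x with
  | nil => intro hx; rw [f4, av2]; exact ⟨by simp, hx⟩
  | cons m w ih =>
    intro hx
    unfold f4
    split_ifs with h
    · rw [av2]
      refine ⟨?_, ih (avoid_tail hx)⟩
      rintro ⟨rfl, h⟩
      rcases f4_head c b c w with h' | h' <;> rw [h'] at h <;> simp at h <;> exact hab h
    · rw [av2]; exact ⟨by simp [h], hx⟩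

theorem f4_cons {a b c : α} {w : List α} (h : w.head? ≠ some b) : f4 a b c w = a :: w := by
  cases w with
  | nil => rfl
  | cons m w => simp at h; simp [f4, h]

open Classical in
noncomputable def lm4 (a b c : α) (l : α) (w : List α) : List α :=
  if l = a then f4 a b c w else l :: w

theorem lm4_red {a b c : α} (hab : a ≠ b) (l : α) :
    ∀ x ∈ Avoid [[a, b]], lm4 a b c l x ∈ Avoid [[a, b]] := by
  intro x hx
  unfold lm4
  split_ifs with h
  · exact f4_red hab x hx
  · rw [av2]; exact ⟨fun h' => h h'.1, hx⟩

theorem uniq_L4b {a b c : α} (hab : a ≠ b) :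
    Uniq {([a, b], [c, a])} (Avoid [[a, b]]) := by
  refine uniq_of (by simp) (lm4 a b c) (lm4_red hab) ?_ ?_
  · intro x hx
    simp only [List.foldr_cons, List.foldr_nil]
    have e : lm4 a b c b x = b :: x := by simp [lm4, hab.symm]
    rw [e]
    have e2 : lm4 a b c a (b :: x) = c :: f4 a b c x := by simp [lm4, f4]
    have e3 : lm4 a b c a x = f4 a b c x := by simp [lm4]
    rw [e2, e3]
    unfold lm4
    split_ifs with h
    · subst h
      refine (f4_cons ?_).symm
      rcases f4_head c b c x with h' | h' <;> rw [h'] <;> simpa using hab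
    · rfl
  · intro l w h
    rw [av2] at h
    unfold lm4
    split_ifs with h'
    · subst h'
      exact f4_cons fun h' => h.1 ⟨rfl, h'⟩
    · rfl

theorem good_L4b [Fintype α] {a b c : α} (hab : a ≠ b) (l : α) :
    Good {([a, b], [c, a])} (Avoid [[a, b]]) Nice (fun x => [l] ++ x) := by
  by_cases hl : l = a
  · subst hl
    refine good_of l (f4 l b c) (f4_red hab) Nice
      (MD {k | ∀ e ∈ k, e = (b, c)} [] [l]) ((Nice_PP _ _).or (Nice_MD (reg_letters _) _ _)) ?_ ?_
    · rintro x y ⟨k, hk, w, rfl, rfl⟩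
      induction k with
      | nil => exact WordEq.refl _ _
      | cons e k ih =>
        have he : e = (b, c) := hk e (by simp)
        subst he
        have := ih (fun e he => hk e (by simp [he]))
        exact (WordEq.base [l, b] [c, l] (k.map Prod.fst ++ w)).trans (this.cons c)
    · intro x hx
      right
      clear hx
      induction x with
      | nil => exact ⟨[], by simp, [], by simp, by simp [f4]⟩
      | cons m w ih =>
        unfold f4
        split_ifs with h
        · subst h
          obtain ⟨k, hk, w', hw, hw'⟩ := ih
          refine ⟨(m, c) :: k, ?_, w', ?_, ?_⟩
          · intro e he
            rcases List.mem_cons.1 he with rfl | he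
            · rfl
            · exact hk e he
          · rw [hw]; simp
          · rw [hw']; simp
        · exact ⟨[], by simp, m :: w, by simp, by simp⟩
  · refine good_triv l fun x hx => ?_
    rw [av2]; exact ⟨fun h => hl h.1, hx⟩

/-- `ab → a` : `a b^n w ↦ a w` -/
def ρ3 (a b : α) (x y : List α) : Prop :=
  ∃ n w, x = List.replicate n b ++ w ∧ y = a :: w

open Classical in
noncomputable def f3 (a b : α) : List α → List α
  | [] => [a]
  | m :: w => if m = b then f3 a b w else a :: m :: w

theorem f3_red {a b : α} : ∀ x ∈ Avoid [[a, b]], f3 a b x ∈ Avoid [[a, b]] := by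
  intro x
  induction x with
  | nil => intro hx; rw [f3, av2]; exact ⟨by simp, hx⟩
  | cons m w ih =>
    intro hx
    unfold f3
    split_ifs with h
    · exact ih (avoid_tail hx)
    · rw [av2]; exact ⟨by simp [h], hx⟩

theorem f3_cons {a b : α} {w : List α} (h : w.head? ≠ some b) : f3 a b w = a :: w := by
  cases w with
  | nil => rfl
  | cons m w => simp at h; simp [f3, h]

open Classical in
noncomputable def lm3 (a b : α) (l : α) (w : List α) : List α :=
  if l = a then f3 a b w else l :: w

theorem lm3_red {a b : α} (l : α) :
    ∀ x ∈ Avoid [[a, b]], lm3 a b l x ∈ Avoid [[a, b]] := by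
  intro x hx
  unfold lm3
  split_ifs with h
  · exact f3_red x hx
  · rw [av2]; exact ⟨fun h' => h h'.1, hx⟩

theorem uniq_L3 {a b : α} (hab : a ≠ b) :
    Uniq {([a, b], [a])} (Avoid [[a, b]]) := by
  refine uniq_of (by simp) (lm3 a b) lm3_red ?_ ?_
  · intro x hx
    simp only [List.foldr_cons, List.foldr_nil]
    have e : lm3 a b b x = b :: x := by simp [lm3, hab.symm]
    rw [e]
    simp [lm3, f3]
  · intro l w h
    rw [av2] at h
    unfold lm3
    split_ifs with h'
    · subst h'
      exact f3_cons fun h' => h.1 ⟨rfl, h'⟩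
    · rfl

theorem reg_ρ3 [Fintype α] (a b : α) : RRE (rv (ρ3 a b)) := by
  have h0 : RR (fun x y : List (Option α) => (∃ n, x = List.replicate n (some b)) ∧ y = []) := by
    refine reg_congr (reg_letters (fun c => c = (some (some b), none))) fun w => ?_
    have e : ∀ n, padR (List.replicate n (some b)) [] =
        List.replicate n ((some (some b), none) : Option (Option α) × Option (Option α)) := by
      intro n
      induction n with
      | zero => simp
      | succ n ih => simp [List.replicate_succ, ih]
    constructor
    · rintro ⟨_, _, ⟨⟨n, rfl⟩, rfl⟩, rfl⟩
      rw [e]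
      intro c hc
      exact List.eq_of_mem_replicate hc
    · intro h
      exact ⟨_, _, ⟨⟨w.length, rfl⟩, rfl⟩, by rw [e]; exact List.eq_replicate_of_mem h⟩
  have h1 := (h0.shift (some a)).sync
    (reg_mul (reg_single [((none : Option α), (none : Option α))]) (reg_map upE reg_Dg))
  have e1 : ∀ k : List (α × α), (k.map upE).map Prod.fst = (k.map Prod.fst).map some := by
    intro k; rw [List.map_map, List.map_map]; rfl
  have e2 : ∀ k : List (α × α), (k.map upE).map Prod.snd = (k.map Prod.snd).map some := by
    intro k; rw [List.map_map, List.map_map]; rfl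
  refine h1.congr fun X Y => ?_
  constructor
  · rintro ⟨x, y, ⟨n, w, hx, hy⟩, rfl, rfl⟩
    obtain ⟨k, hk, k1, k2⟩ := Dg_mk w.reverse
    have hx' : x = w.reverse ++ List.replicate n b := by
      rw [← List.reverse_reverse x, hx]; simp
    have hy' : y = w.reverse ++ [a] := by
      rw [← List.reverse_reverse y, hy]; simp
    refine ⟨_, ⟨_, rfl, _, ⟨k, hk, rfl⟩, rfl⟩, _, _, ⟨_, ⟨⟨n, rfl⟩, rfl⟩, rfl⟩, ?_, ?_⟩
    · rw [List.map_append, e1, k1, hx']; simp [E]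
    · rw [List.map_append, e2, k2, hy']; simp [E]
  · rintro ⟨_, ⟨_, rfl, _, ⟨k, hk, rfl⟩, rfl⟩, _, _, ⟨_, ⟨⟨n, rfl⟩, rfl⟩, rfl⟩, rfl, rfl⟩
    refine ⟨k.map Prod.fst ++ List.replicate n b, k.map Prod.fst ++ [a],
      ⟨n, (k.map Prod.fst).reverse, by simp, by simp⟩, ?_, ?_⟩
    · rw [List.map_append, e1]; simp [E]
    · rw [List.map_append, e2, ← Dg_eq hk]; simp [E]

theorem rv_or (ρ ρ' : List α → List α → Prop) :
    rv (fun x y => ρ x y ∨ ρ' x y) = fun x y => rv ρ x y ∨ rv ρ' x y := rfl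

theorem good_L3 [Fintype α] (a b : α) (l : α) :
    Good {([a, b], [a])} (Avoid [[a, b]]) (fun ρ => RRE (rv ρ)) (fun x => [l] ++ x) := by
  by_cases hl : l = a
  · subst hl
    refine good_of l (f3 l b) f3_red (fun ρ => RRE (rv ρ)) (ρ3 l b) ?_ ?_ ?_
    · change RRE (rv _)
      rw [rv_or]
      exact (Nice_PP _ _).2.2.1.or (reg_ρ3 l b)
    · rintro x y ⟨n, w, rfl, rfl⟩
      induction n with
      | zero => exact WordEq.refl _ _
      | succ n ih =>
        exact (WordEq.base [l, b] [l] (List.replicate n b ++ w)).trans ih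
    · intro x hx
      right
      clear hx
      induction x with
      | nil => exact ⟨0, [], by simp, by simp [f3]⟩
      | cons m w ih =>
        unfold f3
        split_ifs with h
        · subst h
          obtain ⟨n, w', hw, hw'⟩ := ih
          exact ⟨n + 1, w', by simp [List.replicate_succ, ← hw], hw'⟩
        · exact ⟨0, m :: w, by simp, by simp⟩
  · refine (good_triv l fun x hx => ?_).mono fun ρ h => h.2.2.1
    rw [av2]; exact ⟨fun h => hl h.1, hx⟩

/-- `c` is redundant -/
theorem uniq_L5 {p q c : α} (hp : p ≠ c) (hq : q ≠ c) : Uniq {([p, q], [c])} (Avoid [[c]]) := by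
  classical
  refine uniq_of (by simp) (fun l w => if l = c then p :: q :: w else l :: w) ?_ ?_ ?_
  · intro l x hx
    split_ifs with h
    · rw [av1, av1]; exact ⟨hp, hq, hx⟩
    · rw [av1]; exact ⟨h, hx⟩
  · intro x hx
    simp [hp, hq]
  · intro l w h
    rw [if_neg (av1.1 h).1]

theorem good_L5 [Fintype α] {p q c : α} (hp : p ≠ c) (hq : q ≠ c) (l : α) :
    Good {([p, q], [c])} (Avoid [[c]]) Nice (fun x => [l] ++ x) := by
  by_cases hl : l = c
  · subst hl
    refine ⟨_, Nice_PP [] [p, q], ?_, ?_⟩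
    · rintro x y ⟨w, rfl, rfl⟩
      exact (WordEq.base [p, q] [l] _).symm
    · intro x hx
      refine ⟨p :: q :: x, ?_, x, rfl, rfl⟩
      rw [av1, av1]; exact ⟨hp, hq, hx⟩
  · refine good_triv l fun x hx => ?_
    rw [av1]; exact ⟨hl, hx⟩

end Cases

section Case7
variable {α : Type}

open Classical in
noncomputable def f7 (a b : α) : List α → List α
  | [] => [a]
  | [m] => if m = a then [b, b] else [a, m]
  | m :: n :: w =>
    if m = b ∧ n = b then b :: b :: f7 a b w
    else if m = a then b :: b :: n :: w else a :: m :: n :: w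

theorem f7_b (a b : α) (w : List α) : f7 a b (b :: b :: w) = b :: b :: f7 a b w := by
  simp [f7]

theorem f7_a {a b : α} (hab : a ≠ b) (w : List α) : f7 a b (a :: w) = b :: b :: w := by
  cases w <;> simp [f7, hab]

theorem f7_o {a b : α} {x : List α} (h1 : x.head? ≠ some a)
    (h2 : ¬ (x.head? = some b ∧ x.tail.head? = some b)) : f7 a b x = a :: x := by
  match x with
  | [] => simp [f7]
  | [m] => simp at h1; simp [f7, h1]
  | m :: n :: w =>
    simp at h1 h2
    unfold f7
    rw [if_neg (fun h => h2 h.1 h.2), if_neg h1]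

/-- case analysis for `f7` -/
theorem ind7 {a b : α} {P : List α → Prop} (hb : ∀ w, P w → P (b :: b :: w))
    (ha : ∀ w, P (a :: w))
    (ho : ∀ x : List α, x.head? ≠ some a → ¬ (x.head? = some b ∧ x.tail.head? = some b) → P x) :
    ∀ x, P x
  | [] => ho _ (by simp) (by simp)
  | [m] => by
    by_cases h : m = a
    · subst h; exact ha _
    · exact ho _ (by simpa using h) (by simp)
  | m :: n :: w => by
    by_cases h : m = a
    · subst h; exact ha _
    · by_cases h2 : m = b ∧ n = b
      · obtain ⟨rfl, rfl⟩ := h2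
        exact hb _ (ind7 hb ha ho w)
      · exact ho _ (by simpa using h) (by simpa using h2)

theorem f7_red {a b : α} (hab : a ≠ b) :
    ∀ x, x ∈ Avoid [[a, a], [a, b, b]] → f7 a b x ∈ Avoid [[a, a], [a, b, b]] := by
  refine ind7 (a := a) (b := b) ?_ ?_ ?_
  · intro w ih hx
    rw [f7_b, av23, av23]
    exact ⟨fun h => hab h.1.symm, fun h => hab h.1.symm, fun h => hab h.1.symm,
      fun h => hab h.1.symm, ih (avoid_tail (avoid_tail hx))⟩
  · intro w hx
    rw [f7_a hab, av23, av23]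
    exact ⟨fun h => hab h.1.symm, fun h => hab h.1.symm, fun h => hab h.1.symm,
      fun h => hab h.1.symm, avoid_tail hx⟩
  · intro x h1 h2 hx
    rw [f7_o h1 h2, av23]
    exact ⟨fun h => h1 h.2, fun h => h2 h.2, hx⟩

theorem f7_f7 {a b : α} (hab : a ≠ b) :
    ∀ x, x ∈ Avoid [[a, a], [a, b, b]] → f7 a b (f7 a b x) = b :: b :: x := by
  refine ind7 (a := a) (b := b) ?_ ?_ ?_
  · intro w ih hx
    rw [f7_b, f7_b, ih (avoid_tail (avoid_tail hx))]
  · intro w hx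
    rw [f7_a hab, f7_b]
    rw [av23] at hx
    rw [f7_o (fun h => hx.1 ⟨rfl, h⟩) (fun h => hx.2.1 ⟨rfl, h⟩)]
  · intro x h1 h2 hx
    rw [f7_o h1 h2, f7_a hab]

open Classical in
theorem uniq_L7 {a b : α} (hab : a ≠ b) :
    Uniq {([a, a], [b, b])} (Avoid [[a, a], [a, b, b]]) := by
  refine uniq_of (by simp) (fun l w => if l = a then f7 a b w else l :: w) ?_ ?_ ?_
  · intro l x hx
    split_ifs with h
    · exact f7_red hab x hx
    · rw [av23]; exact ⟨fun h' => h h'.1, fun h' => h h'.1, hx⟩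
  · intro x hx
    simp [hab.symm, f7_f7 hab x hx]
  · intro l w h
    split_ifs with h'
    · subst h'
      rw [av23] at h
      exact f7_o (fun h' => h.1 ⟨rfl, h'⟩) (fun h' => h.2.1 ⟨rfl, h'⟩)
    · rfl

theorem good_L7a [Fintype α] {a b : α} (hab : a ≠ b) (l : α) :
    Good {([a, a], [b, b])} (Avoid [[a, a], [a, b, b]]) Nice (fun x => [l] ++ x) := by
  by_cases hl : l = a
  · subst hl
    have hK := reg_star2 (b, b) (b, b)
    have hcomm : ∀ w, WordEq {([l, l], [b, b])} (l :: b :: b :: w) (b :: b :: l :: w) := fun w =>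
      ((WordEq.base [l, l] [b, b] w).cons l).symm.trans (WordEq.base [l, l] [b, b] (l :: w))
    refine good_of l (f7 l b) (f7_red hab) Nice _
      ((Nice_PP _ _).or ((Nice_MD hK [] [l]).or (Nice_MD hK [l] [b, b]))) ?_ ?_
    · rintro x y (⟨_, ⟨n, rfl⟩, w, rfl, rfl⟩ | ⟨_, ⟨n, rfl⟩, w, rfl, rfl⟩)
      · induction n with
        | zero => exact WordEq.refl _ _
        | succ n ih => exact (hcomm _).trans ((ih.cons b).cons b)
      · induction n with
        | zero => exact WordEq.base [l, l] [b, b] w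
        | succ n ih => exact (hcomm _).trans ((ih.cons b).cons b)
    · intro x hx0
      clear hx0
      right
      revert x
      refine ind7 (a := l) (b := b) ?_ ?_ ?_
      · intro w ih
        rw [f7_b]
        rcases ih with ⟨_, ⟨n, rfl⟩, w, e1, e2⟩ | ⟨_, ⟨n, rfl⟩, w, e1, e2⟩
        · left
          refine ⟨_, ⟨n + 1, rfl⟩, w, ?_, ?_⟩
          · rw [e1]; rfl
          · rw [e2]; rfl
        · right
          refine ⟨_, ⟨n + 1, rfl⟩, w, ?_, ?_⟩
          · rw [e1]; rfl
          · rw [e2]; rfl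
      · intro w
        rw [f7_a hab]
        right
        exact ⟨_, ⟨0, rfl⟩, w, rfl, rfl⟩
      · intro x h1 h2
        rw [f7_o h1 h2]
        left
        exact ⟨_, ⟨0, rfl⟩, x, rfl, rfl⟩
  · refine good_triv l fun x hx => ?_
    rw [av23]; exact ⟨fun h' => hl h'.1, fun h' => hl h'.1, hx⟩

open Classical in
noncomputable def fb (a b : α) : List α → List α
  | [] => [b]
  | [m] => [b, m]
  | m :: n :: w => if m = b ∧ n = a then a :: b :: fb a b w else b :: m :: n :: w

theorem fb_b (a b : α) (w : List α) : fb a b (b :: a :: w) = a :: b :: fb a b w := by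
  simp [fb]

theorem fb_o {a b : α} {x : List α}
    (h2 : ¬ (x.head? = some b ∧ x.tail.head? = some a)) : fb a b x = b :: x := by
  match x with
  | [] => simp [fb]
  | [m] => simp [fb]
  | m :: n :: w =>
    simp at h2
    unfold fb
    rw [if_neg (fun h => h2 h.1 h.2)]

theorem indb {a b : α} {P : List α → Prop} (hb : ∀ w, P w → P (b :: a :: w))
    (ho : ∀ x : List α, ¬ (x.head? = some b ∧ x.tail.head? = some a) → P x) :
    ∀ x, P x
  | [] => ho _ (by simp)
  | [m] => ho _ (by simp)
  | m :: n :: w => by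
    by_cases h2 : m = b ∧ n = a
    · obtain ⟨rfl, rfl⟩ := h2
      exact hb _ (indb hb ho w)
    · exact ho _ (by simpa using h2)

theorem fb_red {a b : α} (hab : a ≠ b) :
    ∀ x, x ∈ Avoid [[a, a], [b, b, a]] → fb a b x ∈ Avoid [[a, a], [b, b, a]] ∧
      (x.head? ≠ some a → b :: fb a b x ∈ Avoid [[a, a], [b, b, a]]) := by
  refine indb (a := a) (b := b) ?_ ?_
  · intro w ih hx
    have h1 := avoid_tail hx
    have h2 := avoid_tail h1
    have h3 : w.head? ≠ some a := fun h => (av23'.1 h1).1 ⟨rfl, h⟩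
    have h4 := (ih h2).2 h3
    have h5 : a :: b :: fb a b w ∈ Avoid [[a, a], [b, b, a]] := by
      rw [av23']
      exact ⟨by simp [hab.symm], fun h => hab h.1, h4⟩
    rw [fb_b]
    refine ⟨h5, fun _ => ?_⟩
    rw [av23']
    exact ⟨fun h => hab h.1.symm, by simp [hab], h5⟩
  · intro x h2 hx
    have h5 : b :: x ∈ Avoid [[a, a], [b, b, a]] := by
      rw [av23']
      exact ⟨fun h => hab h.1.symm, fun h => h2 h.2, hx⟩
    rw [fb_o h2]
    refine ⟨h5, fun h => ?_⟩
    rw [av23']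
    exact ⟨fun h => hab h.1.symm, fun h' => h h'.2.2, h5⟩

theorem good_L7b [Fintype α] {a b : α} (hab : a ≠ b) (l : α) :
    Good {([a, a], [b, b])} (Avoid [[a, a], [b, b, a]]) Nice (fun x => [l] ++ x) := by
  have hK := reg_star2 (b, a) (a, b)
  have hcomm : ∀ w, WordEq {([a, a], [b, b])} (b :: b :: a :: w) (a :: b :: b :: w) := fun w =>
      (WordEq.base [a, a] [b, b] (a :: w)).symm.trans ((WordEq.base [a, a] [b, b] w).cons a)
  have hs : ∀ x y, MD {w | ∃ n, w = (List.replicate n [(b, a), (a, b)]).flatten} [] [b] x y →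
      WordEq {([a, a], [b, b])} (b :: x) y := by
    rintro x y ⟨_, ⟨n, rfl⟩, w, rfl, rfl⟩
    induction n with
    | zero => exact WordEq.refl _ _
    | succ n ih => exact (hcomm _).trans ((ih.cons b).cons a)
  have hc : ∀ x, MD {w | ∃ n, w = (List.replicate n [(b, a), (a, b)]).flatten} [] [b] x
      (fb a b x) := by
    refine indb (a := a) (b := b) ?_ ?_
    · rintro w ⟨_, ⟨n, rfl⟩, w', e1, e2⟩
      rw [fb_b]
      refine ⟨_, ⟨n + 1, rfl⟩, w', ?_, ?_⟩
      · rw [e1]; rfl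
      · rw [e2]; rfl
    · intro x h
      rw [fb_o h]
      exact ⟨_, ⟨0, rfl⟩, x, rfl, rfl⟩
  by_cases hb : l = b
  · subst hb
    exact good_of l (fb a l) (fun x hx => (fb_red hab x hx).1) Nice _
      ((Nice_PP _ _).or (Nice_MD hK [] [l])) hs (fun x _ => Or.inr (hc x))
  by_cases ha : l = a
  · subst ha
    refine ⟨_, (Nice_PP [] [l]).or (Nice_MD (reg_mul (reg_single [(l, b)]) hK) [] [b]), ?_, ?_⟩
    · rintro x y (⟨w, rfl, rfl⟩ | ⟨_, ⟨_, rfl, k, hk, rfl⟩, w, rfl, rfl⟩)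
      · exact WordEq.refl _ _
      · exact (WordEq.base [l, l] [b, b] _).trans ((hs _ _ ⟨k, hk, w, rfl, rfl⟩).cons b)
    · intro x hx
      by_cases h : x.head? = some l
      · cases x with
        | nil => simp at h
        | cons m w =>
          simp at h; subst h
          have h1 := avoid_tail hx
          have h3 : w.head? ≠ some m := fun h => (av23'.1 hx).1 ⟨rfl, h⟩
          refine ⟨_, (fb_red hab w h1).2 h3, Or.inr ?_⟩
          obtain ⟨k, hk, w', e1, e2⟩ := hc w
          refine ⟨_, ⟨_, rfl, k, hk, rfl⟩, w', ?_, ?_⟩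
          · rw [e1]; rfl
          · rw [e2]; rfl
      · refine ⟨l :: x, ?_, Or.inl ⟨x, rfl, rfl⟩⟩
        rw [av23']
        exact ⟨fun h' => h h'.2, fun h' => hab h'.1, hx⟩
  · refine good_triv l fun x hx => ?_
    rw [av23']; exact ⟨fun h' => ha h'.1, fun h' => hb h'.1, hx⟩

end Case7

section NonBi
variable {α : Type}

theorem inv_count [DecidableEq α] {a b c : α} (hc : c ≠ b) {x y : List α}
    (h : WordEq {([a, b], [a])} x y) : x.count c = y.count c := by
  refine h.lift (fun x => x.count c) ?_
  rintro _ _ ⟨p, u, v, s, hR, rfl, rfl⟩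
  simp only [Set.mem_singleton_iff, Prod.mk.injEq] at hR
  obtain ⟨rfl, rfl⟩ := hR
  simp [List.count_append, List.count_cons, hc.symm]

theorem inv_take [DecidableEq α] {a b : α} (hab : a ≠ b) {x y : List α}
    (h : WordEq {([a, b], [a])} x y) :
    x.takeWhile (fun c => c = b) = y.takeWhile (fun c => c = b) := by
  refine h.lift (fun x => x.takeWhile (fun c => c = b)) ?_
  rintro _ _ ⟨p, u, v, s, hR, rfl, rfl⟩
  simp only [Set.mem_singleton_iff, Prod.mk.injEq] at hR
  obtain ⟨rfl, rfl⟩ := hR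
  simp [List.takeWhile_append, hab]

/-- a word over `{a, b}` containing `a` absorbs `b` on the right -/
theorem absorb {a b : α} (w : List α) (hw : ∀ c ∈ w, c = a ∨ c = b) (ha : a ∈ w) :
    WordEq {([a, b], [a])} (w ++ [b]) w := by
  induction w using List.reverseRecOn with
  | nil => simp at ha
  | append_singleton w l ih =>
    by_cases hl : l = a
    · subst hl
      simpa using (WordEq.base [l, b] [l] []).left w
    · have hb : l = b := by
        rcases hw l (by simp) with h | h
        · exact absurd h hl
        · exact h
      subst hb
      have ha' : a ∈ w := by
        rcases List.mem_append.1 ha with h | h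
        · exact h
        · simp at h; exact absurd h.symm hl
      exact (ih (fun c hc => hw c (by simp [hc])) ha').right [l]

theorem absorb_pow {a b : α} (w : List α) (hw : ∀ c ∈ w, c = a ∨ c = b) (ha : a ∈ w) (n : ℕ)
    (s : List α) :
    WordEq {([a, b], [a])} (w ++ (List.replicate n b ++ s)) (w ++ s) := by
  induction n with
  | zero => exact WordEq.refl _ _
  | succ n ih =>
    have := (absorb w hw ha).right (List.replicate n b ++ s)
    refine WordEq.trans ?_ ih
    simpa [List.replicate_succ] using this

theorem expand_app {β : Type} (g : β → List α) (x y : List β) :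
    expandW g (x ++ y) = expandW g x ++ expandW g y := by
  simp [expandW]

theorem expand_len {β : Type} (g : β → List α) (C : ℕ) (hC : ∀ b, (g b).length ≤ C)
    (x : List β) : (expandW g x).length ≤ C * x.length := by
  induction x with
  | nil => simp [expandW]
  | cons b x ih =>
    have := hC b
    simp only [expandW, List.map_cons, List.flatten_cons, List.length_append,
      List.length_cons] at ih ⊢
    rw [Nat.mul_succ]
    omega

theorem padR_split {β : Type} (p s y : List β) (h : p.length = y.length) :
    padR (p ++ s) y = padR p y ++ padR s [] := by
  induction p generalizing y with
  | nil =>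
    have : y = [] := by simpa using h.symm
    subst this; simp
  | cons a p ih =>
    cases y with
    | nil => simp at h
    | cons b y => simp at h; simp [ih y h]

theorem nonbi {a b : α} (hab : a ≠ b) {β : Type} [Fintype β] (g : β → List α)
    (L : Set (List β)) (onto : ∀ w : List α, ∃ x ∈ L, WordEq {([a, b], [a])} (expandW g x) w)
    (hreg : ∀ b' : β, IsReg {p | ∃ x ∈ L, ∃ y ∈ L,
      WordEq {([a, b], [a])} (g b' ++ expandW g x) (expandW g y) ∧ p = padR x y}) : False := by
  classical
  obtain ⟨x0, -, h0⟩ := onto [a]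
  have hlet : ∀ c ∈ expandW g x0, c = a ∨ c = b := by
    intro c hc
    by_contra! hn
    have := inv_count hn.2 h0
    have h1 : 0 < (expandW g x0).count c := List.count_pos_iff.2 hc
    simp [hn.1.symm] at this
    omega
  have hmem : a ∈ expandW g x0 := by
    have := inv_count hab h0
    rw [← List.count_pos_iff, this]; simp
  obtain ⟨w, hwm, haw⟩ := List.mem_flatten.1 hmem
  obtain ⟨b', hb', rfl⟩ := List.mem_map.1 hwm
  have hlet' : ∀ c ∈ g b', c = a ∨ c = b := fun c hc =>
    hlet c (List.mem_flatten.2 ⟨_, hwm, hc⟩)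
  -- bound
  obtain ⟨C, hC⟩ : ∃ C, ∀ b, (g b).length ≤ C :=
    ⟨∑ b, (g b).length, fun b =>
      Finset.single_le_sum (f := fun b => (g b).length) (fun _ _ => Nat.zero_le _)
        (Finset.mem_univ b)⟩
  have hC1 : 1 ≤ C := le_trans (List.length_pos_of_mem haw) (hC b')
  have key : ∀ j : ℕ, ∃ p s y : List β, p.length = y.length ∧ (p ++ s) ∈ L ∧ y ∈ L ∧
      (expandW g p).count a = 0 ∧ (expandW g s).count a = j ∧
      (expandW g y).count a = (g b').count a + j ∧
      WordEq {([a, b], [a])} (g b' ++ expandW g (p ++ s)) (expandW g y) := by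
    intro j
    obtain ⟨y, hy, hye⟩ := onto (g b' ++ List.replicate j a)
    obtain ⟨x, hx, hxe⟩ := onto (List.replicate (C * y.length) b ++ List.replicate j a)
    have ht := inv_take hab hxe
    have ht' : (List.replicate (C * y.length) b ++ List.replicate j a).takeWhile
        (fun c => decide (c = b)) = List.replicate (C * y.length) b := by
      rw [List.takeWhile_append_of_pos]
      · cases j <;> simp [List.replicate_succ, hab]
      · intro c hc
        simpa using List.eq_of_mem_replicate hc
    rw [ht'] at ht
    have hpre : List.replicate (C * y.length) b <+: expandW g x := by
      rw [← ht]; exact ⟨_, List.takeWhile_append_dropWhile⟩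
    have hlen : y.length ≤ x.length := by
      have h1 := hpre.length_le
      have h2 := expand_len g C hC x
      simp at h1
      exact Nat.le_of_mul_le_mul_left (h1.trans h2) hC1
    have hp : (x.take y.length).length = y.length := by simp [hlen]
    have hc1 : (expandW g (x.take y.length)).count a = 0 := by
      have h1 : expandW g (x.take y.length) <+: expandW g x := by
        conv_rhs => rw [← List.take_append_drop y.length x, expand_app]
        exact List.prefix_append _ _
      have h2 : expandW g (x.take y.length) <+: List.replicate (C * y.length) b := by
        refine List.prefix_of_prefix_length_le h1 hpre ?_
        have := expand_len g C hC (x.take y.length)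
        rw [hp] at this
        simpa using this
      rw [List.count_eq_zero]
      intro h
      exact hab (List.eq_of_mem_replicate (h2.subset h))
    refine ⟨x.take y.length, x.drop y.length, y, hp, ?_, hy, hc1, ?_, ?_, ?_⟩
    · rw [List.take_append_drop]; exact hx
    · have h1 := inv_count hab hxe
      conv_lhs at h1 => rw [← List.take_append_drop y.length x, expand_app]
      rw [List.count_append, hc1] at h1
      simpa [List.count_append, List.count_replicate, hab.symm] using h1
    · rw [inv_count hab hye]; simp
    · rw [List.take_append_drop]
      exact ((hxe.left (g b')).trans (absorb_pow (g b') hlet' haw _ _)).trans hye.symm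
  choose p s y hpl hpL hyL hcp hcs hcy he using key
  obtain ⟨σ, _, F, st, s₀, hF0, hF⟩ := reg_unfold (hreg b')
  have hfold : ∀ (k z) (q : σ), k ++ z ∈ F q ↔ z ∈ F (k.foldl st q) := by
    intro k z
    induction k with
    | nil => intro q; rfl
    | cons c k ih => intro q; rw [List.cons_append, hF, ih]; rfl
  obtain ⟨i, j, hij, hst⟩ := Finite.exists_ne_map_eq_of_infinite
    (fun j => (padR (p j) (y j)).foldl st s₀)
  have hj : padR (p j ++ s j) (y j) ∈ F s₀ := by
    rw [← hF0]; exact ⟨_, hpL j, _, hyL j, he j, rfl⟩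
  rw [padR_split _ _ _ (hpl j), hfold] at hj
  have hi : padR (p i ++ s j) (y i) ∈ F s₀ := by
    rw [padR_split _ _ _ (hpl i), hfold, hst]; exact hj
  rw [← hF0] at hi
  obtain ⟨X, -, Y, -, hXY, hpad⟩ := hi
  have e1 : p i ++ s j = X := by rw [← padR_fst (p i ++ s j) (y i), hpad, padR_fst]
  have e2 : y i = Y := by rw [← padR_snd (p i ++ s j) (y i), hpad, padR_snd]
  rw [← e1, ← e2] at hXY
  have := inv_count hab hXY
  rw [expand_app, List.count_append, List.count_append, hcp, hcs, hcy] at this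
  omega

theorem nonbi_left {a b : α} (hab : a ≠ b) : ¬ MonBiautomatic {([a, b], [a])} := by
  rintro ⟨β, _, g, L, h⟩
  exact nonbi hab g L h.onto h.mulLR_reg

theorem expand_rev {β : Type} (g : β → List α) (x : List β) :
    (expandW g x).reverse = expandW (fun b => (g b).reverse) x.reverse := by
  induction x with
  | nil => rfl
  | cons b x ih =>
    rw [List.reverse_cons, expand_app, ← ih]
    simp [expandW]

theorem nonbi_right {a b : α} (hab : a ≠ b) : ¬ MonBiautomatic {([a, b], [b])} := by
  rintro ⟨β, _, g, L, h⟩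
  refine nonbi hab.symm (fun b => (g b).reverse) {x | x.reverse ∈ L} ?_ ?_
  · intro w
    obtain ⟨x, hx, hw⟩ := h.onto w.reverse
    refine ⟨x.reverse, by simpa using hx, ?_⟩
    have := hw.rev
    rw [expand_rev, List.reverse_reverse] at this
    exact this
  · intro b'
    refine reg_congr (reg_rev (h.mulRL_reg b')) fun z => ?_
    constructor
    · rintro ⟨x, hx, y, hy, he, rfl⟩
      refine ⟨x.reverse, hx, y.reverse, hy, ?_, ?_⟩
      · have := he.rev
        simpa [expand_rev] using this
      · simp [padL_eq]
    · rintro ⟨x, hx, y, hy, he, hz⟩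
      refine ⟨x.reverse, by simpa using hx, y.reverse, by simpa using hy, ?_, ?_⟩
      · have := he.rev
        simpa [expand_rev] using this
      · rw [padL_eq] at hz
        exact List.reverse_injective hz

end NonBi

section Final
variable {α : Type}

theorem swap_eq (u v : List α) : WordEq {(u, v)} = WordEq {(v, u)} := by
  funext x y
  exact propext ⟨WordEq.of_swap, WordEq.of_swap⟩

theorem prefix_congr {R R' : Set (List α × List α)} (h : WordEq R = WordEq R')
    (H : MonPrefixAutomatic R) : MonPrefixAutomatic R' := by
  obtain ⟨β, i, g, L, H⟩ := H
  refine ⟨β, i, g, L, ⟨⟨H.reg, H.ne, ?_, ?_, ?_⟩, ?_⟩⟩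
  · rw [← h]; exact H.onto
  · rw [← h]; exact H.eq_reg
  · rw [← h]; exact H.mul_reg
  · rw [← h]; exact H.pre_reg

theorem bi_congr {R R' : Set (List α × List α)} (h : WordEq R = WordEq R')
    (H : MonBiautomatic R) : MonBiautomatic R' := by
  obtain ⟨β, i, g, L, H⟩ := H
  refine ⟨β, i, g, L, ⟨H.reg, H.ne, ?_, ?_, ?_, ?_, ?_, ?_, ?_⟩⟩
  · rw [← h]; exact H.onto
  · rw [← h]; exact H.eqR_reg
  · rw [← h]; exact H.eqL_reg
  · rw [← h]; exact H.mulRR_reg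
  · rw [← h]; exact H.mulLR_reg
  · rw [← h]; exact H.mulRL_reg
  · rw [← h]; exact H.mulLL_reg

theorem both_of [Fintype α] {u v u' v' : List α} {F F' : List (List α)} (hF : [] ∉ F)
    (hu : Uniq {(u, v)} (Avoid F))
    (hl : ∀ l, Good {(u, v)} (Avoid F) Nice (fun x => [l] ++ x))
    (hu' : u' = u.reverse) (hv' : v' = v.reverse) (hF' : F' = F.map List.reverse)
    (hr : ∀ l, Good {(u', v')} (Avoid F') Nice (fun x => [l] ++ x)) :
    MonPrefixAutomatic {(u, v)} ∧ MonBiautomatic {(u, v)} := by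
  have hr' : ∀ l, Good {(u, v)} (Avoid F) Nice (fun x => x ++ [l]) := fun l =>
    Good.dual (fun ρ h => h.rv) hu' hv' hF' (hr l)
  exact ⟨prefix_of hF hu fun l => (hr' l).mono fun ρ h => h.1, bi_of hF hu hr' hl⟩

theorem case_L4 [Fintype α] {p q c d : α} (hpq : p ≠ q) (h : ¬ (c = p ∧ d = q)) :
    MonPrefixAutomatic {([p, q], [c, d])} ∧ MonBiautomatic {([p, q], [c, d])} := by
  have hl : ∀ {p q c d : α}, p ≠ q → ¬ (c = p ∧ d = q) →
      ∀ l, Good {([p, q], [c, d])} (Avoid [[p, q]]) Nice (fun x => [l] ++ x) := by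
    intro p q c d hpq h
    by_cases hd : d = p
    · subst hd; exact good_L4b hpq
    · exact lmF_good (red_L4a h hd)
  have hu : Uniq {([p, q], [c, d])} (Avoid [[p, q]]) := by
    by_cases hd : d = p
    · subst hd; exact uniq_L4b hpq
    · exact uniq_L4a hpq h hd
  exact both_of (u' := [q, p]) (v' := [d, c]) (F' := [[q, p]]) (by simp) hu (hl hpq h) rfl rfl rfl
    (hl hpq.symm (fun h' => h h'.symm))

theorem case_L7 [Fintype α] {a b : α} (hab : a ≠ b) :
    MonPrefixAutomatic {([a, a], [b, b])} ∧ MonBiautomatic {([a, a], [b, b])} :=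
  both_of (u' := [a, a]) (v' := [b, b]) (F' := [[a, a], [b, b, a]]) (by simp) (uniq_L7 hab)
    (good_L7a hab) rfl rfl rfl (good_L7b hab)

end Final

/-- let `S = sgp⟨α ∣ u = v⟩` be a one-relator monoid with
`|u| = 2`, `|v| ≤ 2` and `u ≠ v`.  Then `S` is prefix-automatic, and `S` is
biautomatic if and only if the relation is not of the form `ab = a` or
`ab = b` for distinct letters `a, b`. -/
theorem statement_14 {α : Type} [Fintype α] (u v : List α)
    (hu : u.length = 2) (hv : v.length ≤ 2) (huv : u ≠ v)
    (R : Set (List α × List α)) (hRdef : R = {(u, v)}) :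
    MonPrefixAutomatic R ∧
    (MonBiautomatic R ↔ ¬ ∃ a b : α, a ≠ b ∧
      ((u = [a, b] ∧ v = [a]) ∨ (u = [a, b] ∧ v = [b]))) := by
  subst hRdef
  obtain ⟨p, q, rfl⟩ := List.length_eq_two.1 hu
  -- a positive case
  have pos : (MonPrefixAutomatic {([p, q], v)} ∧ MonBiautomatic {([p, q], v)}) →
      (p ≠ q → v ≠ [p] ∧ v ≠ [q]) → MonPrefixAutomatic {([p, q], v)} ∧
    (MonBiautomatic {([p, q], v)} ↔ ¬ ∃ a b : α, a ≠ b ∧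
      (([p, q] = [a, b] ∧ v = [a]) ∨ ([p, q] = [a, b] ∧ v = [b]))) := by
    rintro ⟨h1, h2⟩ h3
    refine ⟨h1, fun _ => ?_, fun _ => h2⟩
    rintro ⟨a, b, hab, h | h⟩
    · simp only [List.cons.injEq, and_true] at h
      obtain ⟨⟨rfl, rfl⟩, h⟩ := h
      exact (h3 hab).1 h
    · simp only [List.cons.injEq, and_true] at h
      obtain ⟨⟨rfl, rfl⟩, h⟩ := h
      exact (h3 hab).2 h
  match v, hv with
  | [], _ =>
    exact pos (both_of (u' := [q, p]) (v' := []) (F' := [[q, p]]) (by simp) (uniq_L1 p q)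
      (lmF_good red_L1) rfl rfl rfl (lmF_good red_L1)) (by simp)
  | [c], _ =>
    by_cases hcp : c = p
    · subst hcp
      by_cases hq : q = c
      · subst hq
        exact pos (both_of (u' := [q, q]) (v' := [q]) (F' := [[q, q]]) (by simp) (uniq_L2 q q)
          (lmF_good red_L2) rfl rfl rfl (lmF_good red_L2)) (fun h => absurd rfl h)
      · have hq' : c ≠ q := fun h => hq h.symm
        refine ⟨?_, fun h => absurd h (nonbi_left hq'), fun h => absurd ⟨c, q, hq', ?_⟩ h⟩
        · exact prefix_of (F := [[c, q]]) (by simp) (uniq_L3 hq') fun l =>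
            Good.dual (u' := [q, c]) (v' := [c]) (F' := [[q, c]]) (Q := Nice)
              (fun ρ h => h.rv.1) rfl rfl rfl (lmF_good red_L2 l)
        · exact Or.inl ⟨rfl, rfl⟩
    · by_cases hcq : c = q
      · subst hcq
        have hp : p ≠ c := fun h => hcp h.symm
        refine ⟨?_, fun h => absurd h (nonbi_right hp), fun h => absurd ⟨p, c, hp, ?_⟩ h⟩
        · exact prefix_of (F := [[p, c]]) (by simp) (uniq_L2 p c) fun l =>
            Good.dual (u' := [c, p]) (v' := [c]) (F' := [[c, p]]) (Q := fun ρ => RRE (rv ρ))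
              (fun ρ h => h) rfl rfl rfl (good_L3 c p l)
        · exact Or.inr ⟨rfl, rfl⟩
      · have h1 : p ≠ c := fun h => hcp h.symm
        have h2 : q ≠ c := fun h => hcq h.symm
        exact pos (both_of (u' := [q, p]) (v' := [c]) (F' := [[c]]) (by simp) (uniq_L5 h1 h2)
          (good_L5 h1 h2) rfl rfl rfl (good_L5 h2 h1)) (fun _ => by simp [hcp, hcq])
  | [c, d], _ =>
    refine pos ?_ (by simp)
    by_cases hpq : p = q
    · subst hpq
      by_cases hcd : c = d
      · subst hcd
        exact case_L7 (fun h => huv (by rw [h]))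
      · have h := case_L4 (p := c) (q := d) (c := p) (d := p) hcd
          (fun h => hcd (h.1.symm.trans h.2))
        exact ⟨prefix_congr (swap_eq _ _) h.1, bi_congr (swap_eq _ _) h.2⟩
    · exact case_L4 hpq (fun h => huv (by rw [h.1, h.2]))
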